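/- arXiv:2504.07036 — 8 statements merged into one kernel-verified Lean document; each statement's English description precedes it below -/
import Mathlib

section
/- Let q ≥ 2 and n be positive integers, and let C ⊆ H_q^n be an equidistant code with common distance d. Then |C| ≤ n(q-1) + 1. -/
/-- If a linear combination of words has vanishing total weight and, in every coordinate, vanishing
total weight on each letter other than `a₀`, then its weighted Hamming distance to any word is
zero. -/
theorem sum_mul_hammingDist_eq_zero {ι α κ : Type*} [Fintype ι] [Fintype α] [DecidableEq α]
    [Fintype κ] (a₀ : α) (w : κ → ι → α) (c : κ → ℚ) (hsum : ∑ k, c k = 0)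
    (hletter : ∀ i, ∀ a ≠ a₀, ∑ k, c k * (if w k i = a then 1 else 0) = 0) (y : ι → α) :
    ∑ k, c k * (hammingDist (w k) y : ℚ) = 0 := by
  have hall : ∀ i a, ∑ k, c k * (if w k i = a then 1 else 0) = 0 := by
    intro i a
    by_cases ha : a = a₀
    · have htotal : ∑ b, ∑ k, c k * (if w k i = b then 1 else 0) = 0 := by
        rw [Finset.sum_comm]
        simpa [← Finset.mul_sum] using hsum
      rw [Finset.sum_eq_single a₀ (fun b _ hb => hletter i b hb) (by simp)] at htotal
      rwa [ha]
    · exact hletter i a ha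
  have hdist : ∀ k, (hammingDist (w k) y : ℚ) = ∑ i, (1 - if w k i = y i then 1 else 0) := by
    intro k
    rw [hammingDist, Finset.card_filter]
    push_cast
    refine Finset.sum_congr rfl fun i _ => ?_
    by_cases h : w k i = y i <;> simp [h]
  simp_rw [hdist, Finset.mul_sum]
  rw [Finset.sum_comm]
  simp [mul_sub, Finset.sum_sub_distrib, hsum, hall, -mul_ite]

/-- An equidistant code with positive distance over an alphabet with a distinguished letter `a₀`
has linearly independent indicator vectors, once the indicators of `a₀` are replaced by a single
constant coordinate. -/
theorem linearIndependent_indicator_of_equidistant {ι α : Type*} [Fintype ι] [Fintype α]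
    [DecidableEq α] (a₀ : α) {d : ℕ} (hd : d ≠ 0) (C : Finset (ι → α))
    (hC : ∀ x ∈ C, ∀ y ∈ C, x ≠ y → hammingDist x y = d) :
    LinearIndependent ℚ fun (x : C) (j : Option (ι × {a // a ≠ a₀})) =>
      j.elim (1 : ℚ) fun p => if x.1 p.1 = p.2.1 then 1 else 0 := by
  rw [Fintype.linearIndependent_iff]
  intro c hc y
  have hsum : ∑ x, c x = 0 := by simpa using congrFun hc none
  have hletter : ∀ i, ∀ a ≠ a₀, ∑ x : C, c x * (if x.1 i = a then 1 else 0) = 0 := by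
    intro i a ha
    simpa using congrFun hc (some (i, ⟨a, ha⟩))
  have hdist := sum_mul_hammingDist_eq_zero a₀ (fun x : C => x.1) c hsum hletter y.1
  have hterm : ∀ x : C, c x * (hammingDist x.1 y.1 : ℚ) =
      c x * d - if x = y then c x * d else 0 := by
    intro x
    by_cases h : x = y
    · simp [h]
    · simp [h, hC x.1 x.2 y.1 y.2 (Subtype.coe_injective.ne h)]
  simp_rw [hterm, Finset.sum_sub_distrib, ← Finset.sum_mul, hsum] at hdist
  simpa [hd] using hdist

/-- Delsarte's bound for equidistant codes: a `q`-ary equidistant code of length `n`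
has at most `n * (q - 1) + 1` codewords. -/
theorem equidistant_code_card_le (q n : ℕ) (hq : 2 ≤ q) (hn : 1 ≤ n)
    (d : ℕ) (C : Finset (Fin n → Fin q))
    (hC : ∀ x ∈ C, ∀ y ∈ C, x ≠ y → hammingDist x y = d) :
    C.card ≤ n * (q - 1) + 1 := by
  by_cases hd : d = 0
  · have hcard : C.card ≤ 1 := Finset.card_le_one.2 fun x hx y hy => by
      by_contra h
      exact h (hammingDist_eq_zero.1 ((hC x hx y hy h).trans hd))
    exact hcard.trans (Nat.le_add_left 1 _)
  · have hcard := (linearIndependent_indicator_of_equidistant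
      (⟨0, by omega⟩ : Fin q) hd C hC).fintype_card_le_finrank
    simpa using hcard
end

section
/- Let S ⊆ ℝ^n be a simplex of size n+1 contained in the unit sphere S^{n−1}. Then the centroid of S is the origin, i.e., the sum of the n+1 points of S equals the zero vector. -/
/-- Unit vectors at mutual distance `d` have mutual inner product `1 - d ^ 2 / 2`. -/
lemma real_inner_eq_of_norm_eq_one_of_dist_eq {E : Type*} [NormedAddCommGroup E]
    [InnerProductSpace ℝ E] {x y : E} {d : ℝ} (hx : ‖x‖ = 1) (hy : ‖y‖ = 1)
    (hd : dist x y = d) : inner ℝ x y = 1 - d ^ 2 / 2 := by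
  have h := norm_sub_sq_real x y
  rw [← dist_eq_norm, hd, hx, hy] at h
  linarith

/-- The coefficients of a linear relation between distinct equidistant unit vectors are all
equal. -/
lemma coeff_eq_of_sum_smul_eq_zero_of_dist_eq {ι E : Type*} [Fintype ι] [NormedAddCommGroup E]
    [InnerProductSpace ℝ E] {v : ι → E} {d : ℝ} (hinj : Function.Injective v)
    (hnorm : ∀ i, ‖v i‖ = 1) (hdist : ∀ i j, i ≠ j → dist (v i) (v j) = d)
    {g : ι → ℝ} (hg : ∑ i, g i • v i = 0) (i j : ι) : g i = g j := by
  classical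
  by_cases hij : i = j
  · rw [hij]
  have hd : d ≠ 0 := fun h => hij (hinj (dist_eq_zero.1 ((hdist i j hij).trans h)))
  have key : ∀ k, (1 - d ^ 2 / 2) * ∑ l, g l + d ^ 2 / 2 * g k = 0 := by
    intro k
    have h : inner ℝ (v k) (∑ l, g l • v l) = 0 := by rw [hg, inner_zero_right]
    rw [inner_sum] at h
    have hterm : ∀ l, inner ℝ (v k) (g l • v l) =
        (1 - d ^ 2 / 2) * g l + if k = l then d ^ 2 / 2 * g l else 0 := by
      intro l
      rw [real_inner_smul_right]
      split_ifs with hkl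
      · rw [← hkl, real_inner_self_eq_norm_sq, hnorm]
        ring
      · rw [real_inner_eq_of_norm_eq_one_of_dist_eq (hnorm k) (hnorm l) (hdist k l hkl)]
        ring
    simpa [hterm, Finset.sum_add_distrib, Finset.mul_sum] using h
  have hd' : d ^ 2 / 2 ≠ 0 := by positivity
  exact mul_left_cancel₀ hd' (by linarith [key i, key j])

/-- A simplex of size `n + 1` on the unit sphere of `ℝ^n` is centered at the origin. -/
theorem simplex_max_centered_at_origin (n : ℕ)
    (v : Fin (n + 1) → EuclideanSpace ℝ (Fin n)) (hinj : Function.Injective v)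
    (hnorm : ∀ i, ‖v i‖ = 1)
    (d : ℝ) (hdist : ∀ i j, i ≠ j → dist (v i) (v j) = d) :
    ∑ i, v i = 0 := by
  have hdep : ¬ LinearIndependent ℝ v := fun h => by
    simpa using h.fintype_card_le_finrank
  obtain ⟨g, hg, i, hi⟩ := Fintype.not_linearIndependent_iff.1 hdep
  have hconst := coeff_eq_of_sum_smul_eq_zero_of_dist_eq hinj hnorm hdist hg
  have hsum : g i • ∑ j, v j = 0 := by
    rw [Finset.smul_sum, ← hg]
    exact Finset.sum_congr rfl fun j _ => by rw [hconst i j]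
  exact (smul_eq_zero.1 hsum).resolve_left hi
end

section
/- Let 0 ≤ l < k ≤ n and let F be an (n,k,l)-family with |F| > k² − k + 1. Then F is a Δ(n,k,l)-system, and consequently |F| ≤ (n − l)/(k − l). -/
/-- An `(n,k,l)`-family: a collection of `k`-subsets of `[n]` any two distinct members
of which intersect in exactly `l` elements. -/
def IsNKLFamily (n k l : ℕ) (F : Finset (Finset (Fin n))) : Prop :=
  (∀ A ∈ F, A.card = k) ∧ ∀ A ∈ F, ∀ B ∈ F, A ≠ B → (A ∩ B).card = l

/-- A `Δ(n,k,l)`-system: a family of `k`-subsets of `[n]` having a common kernel `D` of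
size `l` outside of which the members are pairwise disjoint. -/
def IsDeltaSystem (n k l : ℕ) (F : Finset (Finset (Fin n))) : Prop :=
  (∀ A ∈ F, A.card = k) ∧
    ∃ D : Finset (Fin n), D.card = l ∧ (∀ A ∈ F, D ⊆ A) ∧
      ∀ A ∈ F, ∀ B ∈ F, A ≠ B → Disjoint (A \ D) (B \ D)

open Finset in
theorem sum_card_filter_mem_eq_sum_card_inter {α : Type*} [DecidableEq α]
    (F : Finset (Finset α)) (S : Finset α) :
    ∑ x ∈ S, #{A ∈ F | x ∈ A} = ∑ A ∈ F, #(S ∩ A) := by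
  simp only [← filter_mem_eq_inter]
  exact sum_card_bipartiteAbove_eq_sum_card_bipartiteBelow (fun x A => x ∈ A)

open Finset in
theorem sum_card_filter_mem_mul {α : Type*} [DecidableEq α] [Fintype α]
    (G H : Finset (Finset α)) :
    ∑ x, #{A ∈ G | x ∈ A} * #{B ∈ H | x ∈ B} = ∑ A ∈ G, ∑ B ∈ H, #(A ∩ B) := by
  simp only [← sum_card_filter_mem_eq_sum_card_inter, card_filter, sum_mul]
  rw [sum_comm]
  refine sum_congr rfl fun A _ => ?_
  rw [← sum_filter_add_sum_filter_not univ (· ∈ A)]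
  rw [sum_eq_zero (s := filter (¬ · ∈ A) univ) (by simp +contextual)]
  rw [add_zero, filter_mem_eq_inter, univ_inter]
  exact sum_congr rfl fun x hx => by simp [hx]

namespace IsNKLFamily

open Finset

variable {n k l : ℕ} {F : Finset (Finset (Fin n))}

theorem sum_card_inter (hF : IsNKLFamily n k l F) (hlk : l ≤ k) {A : Finset (Fin n)}
    {G : Finset (Finset (Fin n))} (hG : G ⊆ F) (hA : A ∈ G) :
    ∑ B ∈ G, #(A ∩ B) = (k - l) + #G * l := by
  rw [← add_sum_erase _ _ hA, inter_self, hF.1 A (hG hA),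
    sum_congr rfl fun B hB => hF.2 A (hG hA) B (hG (mem_of_mem_erase hB)) (ne_of_mem_erase hB).symm,
    sum_const, smul_eq_mul, ← card_erase_add_one hA, add_one_mul]
  lia

theorem sum_card_filter_mem (hF : IsNKLFamily n k l F) (hlk : l ≤ k) {A : Finset (Fin n)}
    (hA : A ∈ F) : ∑ x ∈ A, #{B ∈ F | x ∈ B} = (k - l) + #F * l := by
  rw [sum_card_filter_mem_eq_sum_card_inter, hF.sum_card_inter hlk Subset.rfl hA]

theorem sum_card_filter_mem_mul_self (hF : IsNKLFamily n k l F) (hlk : l ≤ k)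
    {G : Finset (Finset (Fin n))} (hG : G ⊆ F) :
    ∑ x, #{A ∈ G | x ∈ A} * #{A ∈ G | x ∈ A} = #G * ((k - l) + #G * l) := by
  rw [sum_card_filter_mem_mul, sum_congr rfl fun A hA => hF.sum_card_inter hlk hG hA,
    sum_const, smul_eq_mul]

theorem sum_card_filter_mem_mul_of_disjoint (hF : IsNKLFamily n k l F)
    {G H : Finset (Finset (Fin n))} (hG : G ⊆ F) (hH : H ⊆ F) (hGH : Disjoint G H) :
    ∑ x, #{A ∈ G | x ∈ A} * #{B ∈ H | x ∈ B} = #G * (#H * l) := by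
  rw [sum_card_filter_mem_mul, sum_congr rfl fun A hA => sum_congr rfl fun B hB =>
    hF.2 A (hG hA) B (hH hB) (disjoint_iff_ne.1 hGH A hA B hB)]
  simp

theorem card_filter_mem_mul_card_filter_notMem_le (hF : IsNKLFamily n k l F) (hlk : l ≤ k)
    (x : Fin n) :
    #{A ∈ F | x ∈ A} * #{A ∈ F | x ∉ A} ≤ (k - l) * #F := by
  have hsum := card_filter_add_card_filter_not (s := F) (x ∈ ·)
  have hGG := hF.sum_card_filter_mem_mul_self hlk (filter_subset (x ∈ ·) F)
  have hHH := hF.sum_card_filter_mem_mul_self hlk (filter_subset (x ∉ ·) F)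
  have hGH := hF.sum_card_filter_mem_mul_of_disjoint (filter_subset (x ∈ ·) F)
    (filter_subset (x ∉ ·) F) (disjoint_filter_filter_not F F (x ∈ ·))
  have hGx : #{A ∈ F.filter (x ∈ ·) | x ∈ A} = #{A ∈ F | x ∈ A} := by
    rw [filter_filter]; simp
  have hHx : #{A ∈ F.filter (x ∉ ·) | x ∈ A} = 0 := by
    rw [filter_filter]; simp
  generalize F.filter (x ∈ ·) = G at *
  generalize F.filter (x ∉ ·) = H at *
  rw [← hsum]
  zify at hGG hHH hGH hGx hHx ⊢
  have hle := single_le_sum (s := univ)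
    (f := fun y => ((#H : ℤ) * #{A ∈ G | y ∈ A} - #G * #{A ∈ H | y ∈ A}) ^ 2)
    (fun _ _ => sq_nonneg _) (mem_univ x)
  have hexp : ∑ y, ((#H : ℤ) * #{A ∈ G | y ∈ A} - #G * #{A ∈ H | y ∈ A}) ^ 2
      = #G * #H * (((k - l : ℕ) : ℤ) * (#G + #H)) := by
    have : ∀ y, ((#H : ℤ) * #{A ∈ G | y ∈ A} - #G * #{A ∈ H | y ∈ A}) ^ 2
        = (#H) ^ 2 * (#{A ∈ G | y ∈ A} * #{A ∈ G | y ∈ A})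
          + (#G) ^ 2 * (#{A ∈ H | y ∈ A} * #{A ∈ H | y ∈ A})
          - 2 * #G * #H * (#{A ∈ G | y ∈ A} * #{A ∈ H | y ∈ A}) := fun y => by ring
    simp only [this, sum_sub_distrib, sum_add_distrib, ← mul_sum, hGG, hHH, hGH]
    ring
  rw [hexp] at hle
  simp only [hGx, hHx] at hle
  rcases eq_or_lt_of_le (show (0 : ℤ) ≤ #G * #H by positivity) with h0 | h0
  · rw [← h0]; positivity
  · refine le_of_mul_le_mul_left ?_ h0
    nlinarith

theorem card_filter_mem_le_or_le (hF : IsNKLFamily n k l F) (hlk : l ≤ k)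
    (hcard : (k - l + 1) ^ 2 < #F) (x : Fin n) :
    #{A ∈ F | x ∈ A} ≤ k - l ∨ #F ≤ #{A ∈ F | x ∈ A} + (k - l) := by
  have h := hF.card_filter_mem_mul_card_filter_notMem_le hlk x
  have hsum := card_filter_add_card_filter_not (s := F) (x ∈ ·)
  by_contra! hc
  rw [← hsum] at h hcard hc
  generalize #{A ∈ F | x ∈ A} = d at *
  generalize #{A ∈ F | x ∉ A} = e at *
  generalize k - l = r at *
  obtain ⟨a, rfl⟩ := Nat.exists_eq_add_of_lt hc.1
  obtain ⟨b, rfl⟩ := Nat.exists_eq_add_of_lt (show r < e by lia)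
  nlinarith [Nat.zero_le (a * b)]

theorem isDeltaSystem_of_subset (hF : IsNKLFamily n k l F) {D : Finset (Fin n)}
    (hD : #D = l) (hDF : ∀ A ∈ F, D ⊆ A) : IsDeltaSystem n k l F := by
  refine ⟨hF.1, D, hD, hDF, fun A hA B hB hAB => ?_⟩
  have hinter : D = A ∩ B :=
    eq_of_subset_of_card_le (subset_inter (hDF A hA) (hDF B hB)) (by rw [hF.2 A hA B hB hAB, hD])
  rw [disjoint_left]
  intro y hyA hyB
  simp only [mem_sdiff] at hyA hyB
  exact hyA.2 (hinter ▸ mem_inter.2 ⟨hyA.1, hyB.1⟩)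

theorem isDeltaSystem_of_inter_card_one (hF : IsNKLFamily n k 1 F) (hk : 1 ≤ k)
    (hcard : k ^ 2 - k + 1 < #F) : IsDeltaSystem n k 1 F := by
  by_cases hx : ∃ x, ∀ A ∈ F, x ∈ A
  · obtain ⟨x, hx⟩ := hx
    exact hF.isDeltaSystem_of_subset (card_singleton x) (by simpa using hx)
  push Not at hx
  have hdeg : ∀ x, #{B ∈ F | x ∈ B} ≤ k := by
    intro x
    obtain ⟨A, hA, hxA⟩ := hx x
    have hcount : ∑ y ∈ A, #{B ∈ F.filter (x ∈ ·) | y ∈ B} = #{B ∈ F | x ∈ B} := by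
      rw [sum_card_filter_mem_eq_sum_card_inter, sum_congr rfl (g := fun _ => 1), card_eq_sum_ones]
      intro B hB
      rw [mem_filter] at hB
      exact hF.2 A hA B hB.1 (by rintro rfl; exact hxA hB.2)
    rw [← hcount, ← hF.1 A hA, card_eq_sum_ones]
    refine sum_le_sum fun y hy => card_le_one.2 fun B hB C hC => ?_
    by_contra hBC
    simp only [mem_filter] at hB hC
    obtain ⟨z, hz⟩ := card_eq_one.1 (hF.2 B hB.1.1 C hC.1.1 hBC)
    have hxz : x ∈ B ∩ C := mem_inter.2 ⟨hB.1.2, hC.1.2⟩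
    have hyz : y ∈ B ∩ C := mem_inter.2 ⟨hB.2, hC.2⟩
    rw [hz, mem_singleton] at hxz hyz
    exact hxA (hxz.trans hyz.symm ▸ hy)
  obtain ⟨A, hA⟩ := card_pos.1 (by lia : 0 < #F)
  have h1 := hF.sum_card_filter_mem hk hA
  have h2 : ∑ x ∈ A, #{B ∈ F | x ∈ B} ≤ #A • k := sum_le_card_nsmul _ _ _ fun x _ => hdeg x
  rw [hF.1 A hA, smul_eq_mul, ← pow_two] at h2
  lia

theorem isDeltaSystem_of_two_le (hF : IsNKLFamily n k l F) (hl : 2 ≤ l) (hlk : l < k)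
    (hcard : k ^ 2 - k + 1 < #F) : IsDeltaSystem n k l F := by
  obtain ⟨r, rfl⟩ := Nat.exists_eq_add_of_le hlk.le
  have hr : 0 < r := by lia
  have hm : (l + r) ^ 2 + 1 < #F + (l + r) := by lia
  have hm1 : (r + 1) ^ 2 < #F := by nlinarith
  have hm2 : (l + 1) * r + 1 < #F := by nlinarith
  have hdich := hF.card_filter_mem_le_or_le hlk.le (by simpa using hm1)
  rw [Nat.add_sub_cancel_left] at hdich
  set D : Finset (Fin n) := {x | #F ≤ #{A ∈ F | x ∈ A} + r} with hD
  have hADcard : ∀ A ∈ F, #(D ∩ A) = l := by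
    intro A hA
    have hdeg := hF.sum_card_filter_mem hlk.le hA
    have hAcard := hF.1 A hA
    rw [← sum_inter_add_sum_sdiff A D, Nat.add_sub_cancel_left] at hdeg
    rw [← card_inter_add_card_sdiff A D] at hAcard
    rw [inter_comm]
    have hup : ∑ x ∈ A ∩ D, #{B ∈ F | x ∈ B} ≤ #(A ∩ D) * #F :=
      sum_le_card_nsmul _ _ _ fun x _ => card_filter_le _ _
    have hlow : #(A ∩ D) * (#F - r) ≤ ∑ x ∈ A ∩ D, #{B ∈ F | x ∈ B} :=
      card_nsmul_le_sum _ _ _ fun x hx => by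
        have := (mem_filter.1 (mem_inter.1 hx).2).2
        lia
    have hup' : ∑ x ∈ A \ D, #{B ∈ F | x ∈ B} ≤ #(A \ D) * r :=
      sum_le_card_nsmul _ _ _ fun x hx => (hdich x).resolve_right fun h =>
        (mem_sdiff.1 hx).2 (by simpa [hD] using h)
    have hlow' : #(A \ D) ≤ ∑ x ∈ A \ D, #{B ∈ F | x ∈ B} := by
      rw [card_eq_sum_ones]
      exact sum_le_sum fun x hx => card_pos.2 ⟨A, mem_filter.2 ⟨hA, (mem_sdiff.1 hx).1⟩⟩
    generalize #(A ∩ D) = h at *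
    generalize #(A \ D) = g at *
    obtain ⟨q, hq⟩ := Nat.exists_eq_add_of_lt (show r < #F by nlinarith)
    rw [show #F - r = q + 1 by lia] at hlow
    rw [hq] at hdeg hup hm1 hm2
    rcases lt_trichotomy h l with hlt | heq | hgt
    · obtain ⟨t, rfl⟩ := Nat.exists_eq_add_of_lt hlt
      have hg : g = r + t + 1 := by lia
      subst hg
      nlinarith
    · exact heq
    · obtain ⟨t, rfl⟩ := Nat.exists_eq_add_of_lt hgt
      nlinarith [Nat.zero_le (t * q)]
  have hDle : #D ≤ l := by
    have h1 := sum_card_filter_mem_eq_sum_card_inter F D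
    rw [sum_congr rfl hADcard, sum_const, smul_eq_mul] at h1
    have h2 : #D * (#F - r) ≤ ∑ x ∈ D, #{B ∈ F | x ∈ B} :=
      card_nsmul_le_sum _ _ _ fun x hx => by
        have := (mem_filter.1 hx).2
        lia
    obtain ⟨q, hq⟩ := Nat.exists_eq_add_of_lt (show r < #F by nlinarith)
    rw [show #F - r = q + 1 by lia] at h2
    by_contra! hgt
    obtain ⟨t, ht⟩ := Nat.exists_eq_add_of_lt hgt
    rw [ht] at h2
    nlinarith
  have hDF : ∀ A ∈ F, D ⊆ A := fun A hA => by
    rw [← inter_eq_left]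
    exact eq_of_subset_of_card_le inter_subset_left (by rw [hADcard A hA]; exact hDle)
  obtain ⟨A, hA⟩ := card_pos.1 (by lia : 0 < #F)
  refine hF.isDeltaSystem_of_subset ?_ hDF
  rw [← hADcard A hA, inter_eq_left.2 (hDF A hA)]

end IsNKLFamily

open Finset in
theorem IsDeltaSystem.card_mul_add_le {n k l : ℕ} {F : Finset (Finset (Fin n))}
    (hF : IsDeltaSystem n k l F) : #F * (k - l) + l ≤ n := by
  obtain ⟨hk, D, hD, hDF, hdisj⟩ := hF
  have hpetals : #(F.biUnion (· \ D)) = #F * (k - l) := by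
    rw [card_biUnion hdisj, sum_congr rfl fun A hA => by
      rw [card_sdiff_of_subset (hDF A hA), hk A hA, hD], sum_const, smul_eq_mul]
  have hDdisj : Disjoint (F.biUnion (· \ D)) D :=
    (disjoint_biUnion_left _ _ _).2 fun _ _ => sdiff_disjoint
  rw [← hpetals, ← hD, ← card_union_of_disjoint hDdisj]
  simpa using card_le_univ (F.biUnion (· \ D) ∪ D)

/-- Deza (1973): an `(n,k,l)`-family of cardinality greater than `k² - k + 1` is a
`Δ(n,k,l)`-system, hence has cardinality at most `(n-l)/(k-l)`. -/
theorem deza_theorem (n k l : ℕ) (hlk : l < k) (hkn : k ≤ n)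
    (F : Finset (Finset (Fin n))) (hF : IsNKLFamily n k l F)
    (hcard : k ^ 2 - k + 1 < F.card) :
    IsDeltaSystem n k l F ∧ (F.card : ℝ) ≤ ((n : ℝ) - l) / ((k : ℝ) - l) := by
  have hΔ : IsDeltaSystem n k l F := by
    rcases (by lia : l = 0 ∨ l = 1 ∨ 2 ≤ l) with rfl | rfl | hl
    · exact hF.isDeltaSystem_of_subset Finset.card_empty fun A _ => Finset.empty_subset A
    · exact hF.isDeltaSystem_of_inter_card_one hlk.le hcard
    · exact hF.isDeltaSystem_of_two_le hl hlk hcard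
  refine ⟨hΔ, ?_⟩
  have hle : (F.card : ℝ) * ((k - l : ℕ) : ℝ) + l ≤ n := by exact_mod_cast hΔ.card_mul_add_le
  rw [Nat.cast_sub hlk.le] at hle
  rw [le_div_iff₀ (sub_pos.2 (by exact_mod_cast hlk))]
  linarith
end

section
/- Let 0 ≤ l < k ≤ n and let F be an (n,k,l)-family with |F| > max{l + 2, (k−l)² + (k−l) + 1}. Then F is a Δ(n,k,l)-system, and consequently |F| ≤ (n − l)/(k − l). -/
open Finset

/-- The number of members of `F` whose image under `g` contains `y`. -/
def imageDegree {ι α : Type*} [DecidableEq α] (F : Finset ι) (g : ι → Finset α) (y : α) : ℕ :=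
  (F.filter fun A => y ∈ g A).card

lemma sum_imageDegree {ι α : Type*} [DecidableEq α] (F : Finset ι) (g : ι → Finset α)
    (X : Finset α) :
    ∑ y ∈ X, imageDegree F g y = ∑ A ∈ F, (X ∩ g A).card := by
  simp only [imageDegree, card_filter]
  rw [sum_comm]
  refine sum_congr rfl fun A _ => ?_
  rw [← card_filter, filter_mem_eq_inter]

lemma sum_imageDegree_mul {ι α : Type*} [DecidableEq α] [Fintype α] (P Q : Finset ι)
    (g : ι → Finset α) :
    ∑ y, imageDegree P g y * imageDegree Q g y = ∑ A ∈ P, ∑ B ∈ Q, (g A ∩ g B).card := by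
  have h (A : ι) : ∑ B ∈ Q, (g A ∩ g B).card = ∑ y, if y ∈ g A then imageDegree Q g y else 0 := by
    rw [← sum_imageDegree, sum_ite_mem, univ_inter]
  simp only [h]
  rw [sum_comm]
  refine sum_congr rfl fun y _ => ?_
  rw [← sum_filter, sum_const, smul_eq_mul, imageDegree]

lemma neg_le_mul_self_int (z : ℤ) : -z ≤ z * z := by
  rcases le_or_gt 0 z with h | h <;> nlinarith

section EquiIntersecting

variable {n k l : ℕ} {F : Finset (Finset (Fin n))}

lemma IsNKLFamily.card_inter (hF : IsNKLFamily n k l F) (hlk : l < k)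
    {A B : Finset (Fin n)} (hA : A ∈ F) (hB : B ∈ F) :
    (A ∩ B).card = l + if A = B then k - l else 0 := by
  by_cases h : A = B
  · subst h
    simp [hF.1 A hA, hlk.le]
  · simp [h, hF.2 A hA B hB h]

lemma IsNKLFamily.sum_sum_card_inter (hF : IsNKLFamily n k l F) (hlk : l < k)
    {P Q : Finset (Finset (Fin n))} (hP : P ⊆ F) (hQ : Q ⊆ F) :
    ∑ A ∈ P, ∑ B ∈ Q, (A ∩ B).card = P.card * Q.card * l + (P ∩ Q).card * (k - l) := by
  have h : ∀ A ∈ P, ∑ B ∈ Q, (A ∩ B).card = Q.card * l + if A ∈ Q then k - l else 0 := by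
    intro A hA
    rw [sum_congr rfl fun B hB => hF.card_inter hlk (hP hA) (hQ hB), sum_add_distrib]
    simp
  rw [sum_congr rfl h, sum_add_distrib, ← sum_filter, filter_mem_eq_inter]
  simp [mul_assoc]

lemma IsNKLFamily.card_sdiff (hF : IsNKLFamily n k l F)
    {A B : Finset (Fin n)} (hA : A ∈ F) (hB : B ∈ F) (h : A ≠ B) : (A \ B).card = k - l := by
  have h1 := card_sdiff_add_card_inter A B
  rw [hF.1 A hA, hF.2 A hA B hB h] at h1
  omega

/-- The product of the numbers of members through and off a point is smaller than
`(k - l) * |F|`. -/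
lemma IsNKLFamily.degree_mul_lt (hF : IsNKLFamily n k l F) (hlk : l < k) (x : Fin n)
    (h0 : 0 < imageDegree F id x) (hN : imageDegree F id x < F.card) :
    imageDegree F id x * (F.card - imageDegree F id x) < (k - l) * F.card := by
  set P := F.filter fun A => x ∈ A with hP
  set Q := F.filter fun A => x ∉ A with hQ
  have hdP : imageDegree F id x = P.card := rfl
  have hPQ : P.card + Q.card = F.card := card_filter_add_card_filter_not _
  have hinter : P ∩ Q = ∅ := by
    ext A
    simp only [hP, hQ, mem_inter, mem_filter, notMem_empty]
    tauto
  have hPF : P ⊆ F := filter_subset _ _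
  have hQF : Q ⊆ F := filter_subset _ _
  have hPP := hF.sum_sum_card_inter hlk hPF hPF
  have hQQ := hF.sum_sum_card_inter hlk hQF hQF
  have hPQ' := hF.sum_sum_card_inter hlk hPF hQF
  have s1 := sum_imageDegree_mul P P (id : Finset (Fin n) → _)
  have s2 := sum_imageDegree_mul Q Q (id : Finset (Fin n) → _)
  have s3 := sum_imageDegree_mul P Q (id : Finset (Fin n) → _)
  simp only [id] at s1 s2 s3
  rw [hPP, inter_self] at s1
  rw [hQQ, inter_self] at s2
  rw [hPQ', hinter, card_empty, zero_mul, add_zero] at s3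
  have c1 : ∑ y, imageDegree P id y = P.card * k := by
    rw [sum_imageDegree, sum_congr rfl fun A hA => by
      rw [univ_inter, id, hF.1 A (hPF hA)], sum_const, smul_eq_mul]
  have c2 : ∑ y, imageDegree Q id y = Q.card * k := by
    rw [sum_imageDegree, sum_congr rfl fun A hA => by
      rw [univ_inter, id, hF.1 A (hQF hA)], sum_const, smul_eq_mul]
  have px : imageDegree P id x = P.card := by
    rw [imageDegree, filter_true_of_mem]
    intro A hA
    exact (mem_filter.1 hA).2
  have qx : imageDegree Q id x = 0 := by
    rw [imageDegree, card_eq_zero, filter_false_of_mem]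
    intro A hA
    exact (mem_filter.1 hA).2
  zify at s1 s2 s3 c1 c2 px qx
  set f : Fin n → ℤ := fun y =>
    (Q.card : ℤ) * imageDegree P id y - (P.card : ℤ) * imageDegree Q id y with hf
  have fx : f x = Q.card * P.card := by simp [hf, px, qx]
  have fsum : ∑ y, f y = 0 := by
    simp only [hf, sum_sub_distrib, ← mul_sum, c1, c2]
    ring
  have fsq : ∑ y, f y * f y
      = (P.card : ℤ) * Q.card * ((k - l : ℕ) : ℤ) * (P.card + Q.card) := by
    have : ∀ y, f y * f y = (Q.card : ℤ) ^ 2 * (imageDegree P id y * imageDegree P id y)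
        - 2 * P.card * Q.card * (imageDegree P id y * imageDegree Q id y)
        + (P.card : ℤ) ^ 2 * (imageDegree Q id y * imageDegree Q id y) := by
      intro y
      simp only [hf]
      ring
    simp only [this, sum_add_distrib, sum_sub_distrib, ← mul_sum]
    rw [s1, s2, s3]
    ring
  have key : f x * f x + f x ≤ ∑ y, f y * f y := by
    have h1 := add_sum_erase univ f (mem_univ x)
    have h2 := add_sum_erase univ (fun y => f y * f y) (mem_univ x)
    have h3 : ∑ y ∈ univ.erase x, (-f y) ≤ ∑ y ∈ univ.erase x, f y * f y := by
      exact sum_le_sum fun y _ => neg_le_mul_self_int (f y)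
    rw [sum_neg_distrib] at h3
    linarith
  rw [fsq, fx] at key
  rw [hdP] at h0 hN ⊢
  have hq : 0 < Q.card := by omega
  rw [show F.card - P.card = Q.card by omega, ← hPQ]
  zify at h0 hq ⊢
  have hpq := mul_pos h0 hq
  by_contra! hcon
  have := mul_le_mul_of_nonneg_left hcon hpq.le
  linarith

/-- In a large family every point lies in at most `k - l + 1` members or avoids at most
`k - l + 1` members. -/
lemma IsNKLFamily.degree_extreme (hF : IsNKLFamily n k l F) (hlk : l < k)
    (hcard : (k - l) ^ 2 + (k - l) + 1 < F.card) (x : Fin n) :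
    imageDegree F id x ≤ k - l + 1 ∨ F.card ≤ imageDegree F id x + (k - l + 1) := by
  by_contra! h
  obtain ⟨h1, h2⟩ := h
  have h3 := hF.degree_mul_lt hlk x (by omega) (by omega)
  obtain ⟨e, he⟩ : ∃ e, F.card = imageDegree F id x + e := ⟨_, (Nat.add_sub_of_le (by omega)).symm⟩
  have hm : 1 ≤ k - l := by omega
  generalize k - l = m at *
  generalize imageDegree F id x = d at *
  rw [he] at h2 h3 hcard
  rw [Nat.add_sub_cancel_left] at h3
  obtain ⟨a, rfl⟩ : ∃ a, d = m + 2 + a := ⟨_, (Nat.add_sub_of_le (by omega)).symm⟩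
  obtain ⟨b, rfl⟩ : ∃ b, e = m + 2 + b := ⟨_, (Nat.add_sub_of_le (by omega)).symm⟩
  obtain ⟨c, rfl⟩ : ∃ c, m = 1 + c := ⟨_, (Nat.add_sub_of_le (by omega)).symm⟩
  nlinarith [mul_nonneg (Nat.zero_le a) (Nat.zero_le b)]

end EquiIntersecting

section Weights

variable {ι : Type*} {F : Finset ι} {t : ι → ℤ} {m : ℤ}

lemma sum_weight_le (hm : 1 ≤ m) (hN : m ^ 2 + m + 2 ≤ F.card)
    (h : ∀ A ∈ F, 2 * m + F.card * t A + ∑ B ∈ F, t B ≤ 2 * (m + 1) * (m + t A)) :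
    ∑ B ∈ F, t B ≤ m ^ 2 + m := by
  have hs := sum_le_sum h
  simp only [sum_add_distrib, ← mul_sum, sum_const, nsmul_eq_mul] at hs
  generalize ∑ B ∈ F, t B = T at *
  generalize (F.card : ℤ) = N at *
  by_contra! hT
  have h1 : T * (N - m - 1) ≤ m ^ 2 * N := by nlinarith
  have h2 : (m ^ 2 + m + 1) * (N - m - 1) ≤ T * (N - m - 1) :=
    mul_le_mul_of_nonneg_right (by linarith) (by nlinarith)
  nlinarith

/-- A negative weight forces the extremal configuration. -/
lemma eq_of_weight_neg [DecidableEq ι] (hm : 1 ≤ m) (hN : m ^ 2 + m + 2 ≤ F.card)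
    (hT : ∑ B ∈ F, t B ≤ m ^ 2 + m) (hpair : ∀ A ∈ F, ∀ B ∈ F, A ≠ B → 0 ≤ t A + t B)
    {E : ι} (hE : E ∈ F) (hneg : t E < 0) :
    t E = -1 ∧ (F.card : ℤ) = m ^ 2 + m + 2 ∧ ∀ B ∈ F, B ≠ E → t B = 1 := by
  have hsum := add_sum_erase F t hE
  have hc : ((F.erase E).card : ℤ) = F.card - 1 := by
    rw [card_erase_of_mem hE, Nat.cast_sub (card_pos.2 ⟨E, hE⟩), Nat.cast_one]
  have hge : ∀ B ∈ F.erase E, -t E ≤ t B := fun B hB => by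
    have := hpair E hE B (mem_of_mem_erase hB) (ne_of_mem_erase hB).symm
    linarith
  have h1 := card_nsmul_le_sum _ _ _ hge
  rw [nsmul_eq_mul, hc] at h1
  have hE1 : t E = -1 := by
    by_contra hne
    have : t E ≤ -2 := by omega
    nlinarith
  rw [hE1] at h1 hsum hge
  have hNe : (F.card : ℤ) = m ^ 2 + m + 2 := by linarith
  refine ⟨hE1, hNe, fun B hB hBE => ?_⟩
  have hB' : B ∈ F.erase E := mem_erase.2 ⟨hBE, hB⟩
  have h2 : ∑ C ∈ F.erase E, (1 : ℤ) = ∑ C ∈ F.erase E, t C :=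
    le_antisymm (sum_le_sum fun C hC => by simpa using hge C hC)
      (by rw [sum_const, nsmul_eq_mul, hc]; linarith)
  exact ((sum_eq_sum_iff_of_le fun C hC => by simpa using hge C hC).1 h2 B hB').symm

end Weights

section Normalized

variable {n k l : ℕ} {F : Finset (Finset (Fin n))}

lemma card_sdiff_add_card_sdiff_eq {α : Type*} [DecidableEq α] [Fintype α] (A B L : Finset α) :
    (A \ L).card + (L \ B).card = (symmDiff A L ∩ symmDiff B L).card + (A \ B).card := by
  have h (X : Finset α) : X.card = ∑ y, if y ∈ X then 1 else 0 := by simp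
  rw [h (A \ L), h (L \ B), h (_ ∩ _), h (A \ B), ← sum_add_distrib, ← sum_add_distrib]
  refine sum_congr rfl fun y _ => ?_
  by_cases hA : y ∈ A <;> by_cases hB : y ∈ B <;> by_cases hL : y ∈ L <;>
    simp [mem_symmDiff, hA, hB, hL]

lemma imageDegree_symmDiff_of_notMem {L : Finset (Fin n)} {y : Fin n} (hy : y ∉ L) :
    imageDegree F (symmDiff · L) y = imageDegree F id y := by
  simp [imageDegree, mem_symmDiff, hy]

lemma imageDegree_symmDiff_of_mem {L : Finset (Fin n)} {y : Fin n} (hy : y ∈ L) :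
    imageDegree F id y + imageDegree F (symmDiff · L) y = F.card := by
  simp only [imageDegree, mem_symmDiff, hy, id, not_true, and_false, true_and, false_or]
  exact card_filter_add_card_filter_not _

lemma IsNKLFamily.sum_card_sdiff (hF : IsNKLFamily n k l F) {A : Finset (Fin n)} (hA : A ∈ F) :
    ∑ B ∈ F, (A \ B).card = (F.card - 1) * (k - l) ∧
      ∑ B ∈ F, (B \ A).card = (F.card - 1) * (k - l) := by
  constructor <;> rw [← add_sum_erase F _ hA]
  · rw [sum_congr rfl fun B hB => hF.card_sdiff hA (mem_of_mem_erase hB) (ne_of_mem_erase hB).symm]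
    simp [card_erase_of_mem hA]
  · rw [sum_congr rfl fun B hB => hF.card_sdiff (mem_of_mem_erase hB) hA (ne_of_mem_erase hB)]
    simp [card_erase_of_mem hA]

lemma le_of_mul_le {N m w : ℕ} (hN : m ^ 2 + m + 1 < N)
    (h : w * (N - (m + 1)) ≤ (N - 1) * m) : w ≤ m := by
  by_contra! hw
  obtain ⟨c, rfl⟩ : ∃ c, N = m ^ 2 + m + 2 + c := ⟨_, (Nat.add_sub_of_le (by omega)).symm⟩
  have h1 := Nat.mul_le_mul_right (m ^ 2 + m + 2 + c - (m + 1)) (Nat.succ_le_of_lt hw)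
  rw [show m ^ 2 + m + 2 + c - (m + 1) = m ^ 2 + 1 + c by omega] at h h1
  rw [show m ^ 2 + m + 2 + c - 1 = m ^ 2 + m + 1 + c by omega] at h
  simp only [Nat.succ_eq_add_one] at h1
  nlinarith

lemma IsNKLFamily.card_sdiff_le (hF : IsNKLFamily n k l F)
    (hcard : (k - l) ^ 2 + (k - l) + 1 < F.card) {L : Finset (Fin n)}
    (hL : ∀ y, imageDegree F (symmDiff · L) y ≤ k - l + 1) {A : Finset (Fin n)} (hA : A ∈ F) :
    (A \ L).card ≤ k - l ∧ (L \ A).card ≤ k - l := by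
  constructor <;> refine le_of_mul_le hcard ?_
  · rw [← (hF.sum_card_sdiff hA).1]
    calc (A \ L).card * (F.card - (k - l + 1))
        ≤ ∑ y ∈ A \ L, imageDegree F (fun B => Bᶜ) y := by
          rw [← smul_eq_mul]
          refine card_nsmul_le_sum _ _ _ fun y hy => ?_
          have h1 := hL y
          rw [imageDegree_symmDiff_of_notMem (mem_sdiff.1 hy).2] at h1
          have h2 : imageDegree F id y + imageDegree F (fun B => Bᶜ) y = F.card := by
            simp only [imageDegree, mem_compl, id]
            exact card_filter_add_card_filter_not _
          omega
      _ = ∑ B ∈ F, ((A \ L) ∩ Bᶜ).card := sum_imageDegree _ _ _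
      _ ≤ ∑ B ∈ F, (A \ B).card := sum_le_sum fun B _ => card_le_card fun y hy => by
          simp only [mem_inter, mem_sdiff, mem_compl] at hy ⊢
          tauto
  · rw [← (hF.sum_card_sdiff hA).2]
    calc (L \ A).card * (F.card - (k - l + 1))
        ≤ ∑ y ∈ L \ A, imageDegree F id y := by
          rw [← smul_eq_mul]
          refine card_nsmul_le_sum _ _ _ fun y hy => ?_
          have h1 := hL y
          have h2 := imageDegree_symmDiff_of_mem (F := F) (mem_sdiff.1 hy).1
          omega
      _ = ∑ B ∈ F, ((L \ A) ∩ B).card := sum_imageDegree _ _ _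
      _ ≤ ∑ B ∈ F, (B \ A).card := sum_le_sum fun B _ => card_le_card fun y hy => by
          simp only [mem_inter, mem_sdiff] at hy ⊢
          tauto

/-- If every point has degree at most `k - l + 1` after each member of a large family is replaced
by its symmetric difference with `L`, then all these symmetric differences have size `k - l`. -/
lemma IsNKLFamily.card_symmDiff_eq (hF : IsNKLFamily n k l F) (hlk : l < k)
    (hcard : (k - l) ^ 2 + (k - l) + 1 < F.card) {L : Finset (Fin n)}
    (hL : ∀ y, imageDegree F (symmDiff · L) y ≤ k - l + 1) {A : Finset (Fin n)} (hA : A ∈ F) :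
    (A \ L).card + (L \ A).card = k - l := by
  obtain ⟨m, hm⟩ : ∃ m, k - l = m := ⟨_, rfl⟩
  have hm1 : (1 : ℤ) ≤ m := by omega
  set g : Finset (Fin n) → Finset (Fin n) := (symmDiff · L) with hg
  set t : Finset (Fin n) → ℤ := fun A => ((A \ L).card : ℤ) + (L \ A).card - m with ht
  have hgA (A) : ((g A).card : ℤ) = m + t A := by
    have := card_sdiff_add_card_sdiff_eq A A L
    simp only [inter_self, sdiff_self, bot_eq_empty, card_empty, add_zero] at this
    simp only [ht, hg]
    omega
  have hwv : ∀ A ∈ F, ((L \ A).card : ℤ) = (A \ L).card + (L.card - k) := fun A hA => by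
    have h1 := card_sdiff_add_card A L
    have h2 := card_sdiff_add_card L A
    rw [union_comm, hF.1 A hA] at h2
    omega
  have hgi : ∀ A ∈ F, ∀ B ∈ F, A ≠ B → 2 * ((g A ∩ g B).card : ℤ) = t A + t B := by
    intro A hA B hB hAB
    have h1 := card_sdiff_add_card_sdiff_eq A B L
    rw [hF.card_sdiff hA hB hAB, hm] at h1
    have h2 := hwv A hA
    have h3 := hwv B hB
    simp only [ht, hg]
    omega
  have hpair : ∀ A ∈ F, ∀ B ∈ F, A ≠ B → 0 ≤ t A + t B := fun A hA B hB hAB => by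
    rw [← hgi A hA B hB hAB]; positivity
  have hdeg : ∀ A ∈ F, 2 * ∑ y ∈ g A, (imageDegree F g y : ℤ)
      = 2 * m + F.card * t A + ∑ B ∈ F, t B := by
    intro A hA
    rw [← Nat.cast_sum, sum_imageDegree, Nat.cast_sum, mul_sum]
    have h1 : ∀ B ∈ F, 2 * ((g A ∩ g B).card : ℤ) = t A + t B + if A = B then 2 * (m : ℤ) else 0 := by
      intro B hB
      by_cases hAB : A = B
      · subst hAB
        rw [inter_self, hgA, if_pos rfl]
        ring
      · rw [hgi A hA B hB hAB, if_neg hAB, add_zero]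
    rw [sum_congr rfl h1]
    simp only [sum_add_distrib, sum_const, sum_ite_eq, hA, if_true, nsmul_eq_mul]
    ring
  have hdegle (y) : (imageDegree F g y : ℤ) ≤ m + 1 := by
    have := hL y
    rw [hm] at this
    exact_mod_cast this
  have hstar : ∀ A ∈ F, 2 * m + F.card * t A + ∑ B ∈ F, t B ≤ 2 * ((m : ℤ) + 1) * (m + t A) := by
    intro A hA
    rw [← hdeg A hA, ← hgA]
    have := sum_le_card_nsmul (g A) (fun y => (imageDegree F g y : ℤ)) (m + 1)
      fun y _ => hdegle y
    rw [nsmul_eq_mul] at this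
    linarith
  have hN : (m : ℤ) ^ 2 + m + 2 ≤ F.card := by
    rw [hm] at hcard
    exact_mod_cast hcard
  have hT := sum_weight_le hm1 hN hstar
  have hnonneg : ∀ E ∈ F, 0 ≤ t E := by
    intro E hE
    by_contra! hneg
    obtain ⟨hE1, hNe, hone⟩ := eq_of_weight_neg hm1 hN hT hpair hE hneg
    have hTe : ∑ B ∈ F, t B = F.card - 2 := by
      rw [← add_sum_erase F t hE, hE1, sum_congr rfl fun B hB =>
        hone B (mem_of_mem_erase hB) (ne_of_mem_erase hB), sum_const, card_erase_of_mem hE,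
        nsmul_eq_mul, Nat.cast_sub (card_pos.2 ⟨E, hE⟩)]
      push_cast
      ring
    have hpt : ∀ y, ((m : ℤ) + 1) ∣ (imageDegree F g y : ℤ) - if y ∈ g E then 1 else 0 := by
      intro y
      by_cases hy : y ∈ g E
      · have h1 : F.filter (fun B => y ∈ g B) = {E} := by
          refine eq_singleton_iff_unique_mem.2 ⟨mem_filter.2 ⟨hE, hy⟩, fun B hB => ?_⟩
          obtain ⟨hB, hyB⟩ := mem_filter.1 hB
          by_contra hBE
          have h2 := hgi B hB E hE hBE
          have h3 := card_pos.2 ⟨y, mem_inter.2 ⟨hyB, hy⟩⟩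
          have h4 := hone B hB hBE
          omega
        rw [imageDegree, h1]
        simp [hy]
      · rw [if_neg hy, sub_zero]
        rcases (F.filter fun B => y ∈ g B).eq_empty_or_nonempty with h0 | ⟨B, hB⟩
        · rw [imageDegree, h0]
          simp
        · obtain ⟨hB, hyB⟩ := mem_filter.1 hB
          have hBE : B ≠ E := by
            rintro rfl
            exact hy hyB
          have h2 : ∑ z ∈ g B, (imageDegree F g z : ℤ) = ∑ z ∈ g B, ((m : ℤ) + 1) := by
            have h3 := hdeg B hB
            rw [hone B hB hBE, hTe, hNe] at h3
            rw [sum_const, nsmul_eq_mul, hgA, hone B hB hBE]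
            linarith
          rw [(sum_eq_sum_iff_of_le fun z _ => hdegle z).1 h2 y hyB]
    have hdvd : ((m : ℤ) + 1) ∣ ((E \ L).card : ℤ) + 1 := by
      have h1 := dvd_sum (s := Lᶜ) fun y _ => hpt y
      have h2 (B) : Lᶜ ∩ g B = B \ L := by
        ext y
        simp only [hg, mem_inter, mem_compl, mem_symmDiff, mem_sdiff]
        tauto
      have h3 : ∀ B ∈ F.erase E, ((B \ L).card : ℤ) = (E \ L).card + 1 := by
        intro B hB
        have h4 := hone B (mem_of_mem_erase hB) (ne_of_mem_erase hB)
        have h5 := hwv B (mem_of_mem_erase hB)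
        have h6 := hwv E hE
        simp only [ht] at h4 hE1
        omega
      rw [sum_sub_distrib, ← Nat.cast_sum, sum_imageDegree, sum_ite_mem, Nat.cast_sum] at h1
      simp only [h2] at h1
      rw [← add_sum_erase F _ hE, sum_congr rfl h3] at h1
      simp only [sum_const, card_erase_of_mem hE, nsmul_eq_mul,
        Nat.cast_sub (card_pos.2 ⟨E, hE⟩), hNe, mul_one, add_sub_cancel_left] at h1
      have h4 : (E \ L).card + 1 = ((m : ℤ) ^ 2 + m + 2 - (1 : ℕ)) * ((E \ L).card + 1)
          - (m + 1) * (m * ((E \ L).card + 1)) := by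
        push_cast
        ring
      rw [h4]
      exact dvd_sub h1 (dvd_mul_right _ _)
    have := Int.le_of_dvd (by positivity) hdvd
    simp only [ht] at hE1
    omega
  have hzero : t A = 0 := by
    by_contra hne
    have hpos : 0 < t A := lt_of_le_of_ne (hnonneg A hA) (Ne.symm hne)
    have hpar : ∀ B ∈ F, t B % 2 = t A % 2 := by
      intro B hB
      by_cases hAB : A = B
      · rw [hAB]
      · have := hgi A hA B hB hAB
        omega
    rcases Int.emod_two_eq_zero_or_one (t A) with heven | hodd
    · set Z := F.filter fun B => t B = 0 with hZ
      have hZF : ∀ B ∈ Z, B ∈ F := fun B hB => (mem_filter.1 hB).1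
      have hZ0 : ∀ B ∈ Z, t B = 0 := fun B hB => (mem_filter.1 hB).2
      have h1 : 2 * (F.card : ℤ) - 2 * Z.card ≤ ∑ B ∈ F, t B := by
        have h2 : ∑ B ∈ F, ((2 : ℤ) - if t B = 0 then 2 else 0) ≤ ∑ B ∈ F, t B := by
          refine sum_le_sum fun B hB => ?_
          have h3 := hpar B hB
          have h4 := hnonneg B hB
          split_ifs <;> omega
        rw [sum_sub_distrib, ← sum_filter, sum_const, sum_const, nsmul_eq_mul, nsmul_eq_mul] at h2
        linarith
      have h5 : (Z.card : ℤ) * t A ≤ 2 * (m + t A) := by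
        have h6 : ∑ B ∈ Z, (g A ∩ g B).card ≤ (g A).card := by
          rw [← card_biUnion]
          · exact card_le_card (biUnion_subset.2 fun B _ => inter_subset_left)
          · intro B hB C hC hBC
            have h7 := hgi B (hZF B hB) C (hZF C hC) hBC
            rw [hZ0 B hB, hZ0 C hC] at h7
            have h8 : g B ∩ g C = ∅ := card_eq_zero.1 (by omega)
            exact (disjoint_iff_inter_eq_empty.2 h8).mono inter_subset_right inter_subset_right
        have h9 : ∀ B ∈ Z, 2 * ((g A ∩ g B).card : ℤ) = t A := by
          intro B hB
          rw [hgi A hA B (hZF B hB) (by rintro rfl; exact hne (hZ0 A hB)), hZ0 B hB, add_zero]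
        rw [← hgA, ← nsmul_eq_mul, ← sum_const, ← sum_congr rfl h9, ← mul_sum]
        exact_mod_cast Nat.mul_le_mul_left 2 h6
      have h10 : 2 ≤ t A := by omega
      have h11 : (m : ℤ) ^ 2 + m + 4 ≤ 2 * Z.card := by linarith
      have h12 : (m : ℤ) = 1 := by nlinarith
      have h13 := hF.card_sdiff_le hcard hL hA
      have h14 : t A ≤ m := by
        simp only [ht]
        omega
      omega
    · have h1 := card_nsmul_le_sum F t 1 fun B hB => by
        have h2 := hpar B hB
        have h3 := hnonneg B hB
        omega
      rw [nsmul_eq_mul] at h1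
      linarith
  simp only [ht] at hzero
  omega

end Normalized

/-- The pairwise disjoint sets `A \ D` fit into the complement of the kernel `D`. -/
lemma IsDeltaSystem.card_mul_le {n k l : ℕ} {F : Finset (Finset (Fin n))}
    (hF : IsDeltaSystem n k l F) : F.card * (k - l) + l ≤ n := by
  obtain ⟨hk, D, hD, hDA, hdisj⟩ := hF
  have h1 : ∑ A ∈ F, (A \ D).card = F.card * (k - l) := by
    rw [sum_congr rfl fun A hA => by rw [card_sdiff_of_subset (hDA A hA), hk A hA, hD]]
    simp
  rw [← h1, ← card_biUnion hdisj, ← hD, ← card_union_of_disjoint]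
  · exact card_finset_fin_le _
  · rw [disjoint_biUnion_left]
    exact fun A _ => sdiff_disjoint

lemma IsNKLFamily.isDeltaSystem {n k l : ℕ} {F : Finset (Finset (Fin n))}
    (hF : IsNKLFamily n k l F) (hlk : l < k)
    (hcard : max (l + 2) ((k - l) ^ 2 + (k - l) + 1) < F.card) : IsDeltaSystem n k l F := by
  obtain ⟨hl, hc⟩ := max_lt_iff.1 hcard
  set L : Finset (Fin n) := univ.filter fun y => k - l + 1 < imageDegree F id y with hLdef
  have hL : ∀ y, imageDegree F (symmDiff · L) y ≤ k - l + 1 := by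
    intro y
    by_cases hy : y ∈ L
    · have h1 := imageDegree_symmDiff_of_mem (F := F) hy
      have h2 := hF.degree_extreme hlk hc y
      have h3 := (mem_filter.1 hy).2
      omega
    · rw [imageDegree_symmDiff_of_notMem hy]
      simpa [hLdef] using hy
  have hsize := fun A (hA : A ∈ F) => hF.card_symmDiff_eq hlk hc hL hA
  have hwv : ∀ A ∈ F, (A \ L).card + L.card = (L \ A).card + k := fun A hA => by
    have h1 := card_sdiff_add_card A L
    have h2 := card_sdiff_add_card L A
    rw [union_comm, hF.1 A hA] at h2
    omega
  have hdisj : ∀ A ∈ F, ∀ B ∈ F, A ≠ B → Disjoint (symmDiff A L) (symmDiff B L) := by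
    intro A hA B hB hAB
    rw [disjoint_iff_inter_eq_empty, ← card_eq_zero]
    have h1 := card_sdiff_add_card_sdiff_eq A B L
    rw [hF.card_sdiff hA hB hAB] at h1
    have h2 := hwv A hA
    have h3 := hwv B hB
    have h4 := hsize A hA
    have h5 := hsize B hB
    omega
  have hsub : ∀ A ∈ F, L ⊆ A := by
    intro A hA
    by_contra hLA
    have hpos : 0 < (L \ A).card := card_pos.2 (sdiff_nonempty.2 hLA)
    have h1 : ∑ B ∈ F, (L \ B).card ≤ L.card := by
      rw [← card_biUnion fun B hB C hC hBC =>
        (hdisj B hB C hC hBC).mono le_sup_right le_sup_right]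
      exact card_le_card (biUnion_subset.2 fun B _ => sdiff_subset)
    have h2 : ∀ B ∈ F, (L \ B).card = (L \ A).card := fun B hB => by
      have h3 := hwv A hA
      have h4 := hwv B hB
      have h5 := hsize A hA
      have h6 := hsize B hB
      omega
    rw [sum_congr rfl h2, sum_const, smul_eq_mul] at h1
    have h3 := hwv A hA
    have h4 := hsize A hA
    have h5 : L.card = l + 2 * (L \ A).card := by omega
    obtain ⟨c, hc⟩ : ∃ c, F.card = l + 3 + c := ⟨_, (Nat.add_sub_of_le (by omega)).symm⟩
    rw [h5, hc] at h1
    nlinarith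
  refine ⟨hF.1, L, ?_, hsub, fun A hA B hB hAB =>
    (hdisj A hA B hB hAB).mono le_sup_left le_sup_left⟩
  obtain ⟨A, hA⟩ : F.Nonempty := card_pos.1 (by omega)
  have h1 := hwv A hA
  have h2 := hsize A hA
  rw [sdiff_eq_empty_iff_subset.2 (hsub A hA), card_empty] at h1 h2
  omega

/-- Deza–Frankl (1981): an `(n,k,l)`-family of cardinality greater than `max {l + 2, (k-l)² + (k-l) + 1}` is a
`Δ(n,k,l)`-system, hence has cardinality at most `(n-l)/(k-l)`. -/
theorem deza_frankl_theorem (n k l : ℕ) (hlk : l < k) (hkn : k ≤ n)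
    (F : Finset (Finset (Fin n))) (hF : IsNKLFamily n k l F)
    (hcard : max (l + 2) ((k - l) ^ 2 + (k - l) + 1) < F.card) :
    IsDeltaSystem n k l F ∧ (F.card : ℝ) ≤ ((n : ℝ) - l) / ((k : ℝ) - l) := by
  have h := hF.isDeltaSystem hlk hcard
  refine ⟨h, ?_⟩
  have hlk' : (l : ℝ) < k := by exact_mod_cast hlk
  rw [le_div_iff₀ (by linarith), le_sub_iff_add_le, ← Nat.cast_sub hlk.le]
  exact_mod_cast h.card_mul_le
end

section
/- Let C ⊆ H_2^n be a binary equidistant code with even common distance d > 0. Then |C| ≤ max{(d² + 2d + 8)/4, ⌊2n/d⌋}. In particular, if n ≥ d(d² + 2d + 8)/8, then |C| ≤ ⌊2n/d⌋. -/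
open Finset

/-- The sets `S x`, `x ∈ C`, have pairwise symmetric differences of size `2 * k`. -/
def SymmDiffEquidistant {ι α : Type*} [DecidableEq α] (C : Finset ι) (S : ι → Finset α)
    (k : ℕ) : Prop :=
  ∀ x ∈ C, ∀ y ∈ C, x ≠ y → #(S x) + #(S y) = 2 * k + 2 * #(S x ∩ S y)

section

variable {ι α : Type*} [DecidableEq α]

theorem card_inter_eq_sum_indicator [Fintype α] (s t : Finset α) :
    (#(s ∩ t) : ℤ) = ∑ i, (if i ∈ s then 1 else 0) * (if i ∈ t then 1 else 0) := by
  simp [← ite_and, ← mem_inter, inter_comm]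

theorem sum_sq_weighted_degree [Fintype α] (C : Finset ι) (S : ι → Finset α) (w : ι → ℤ) :
    ∑ i, (∑ x ∈ C, w x * (if i ∈ S x then 1 else 0)) ^ 2 =
      ∑ x ∈ C, ∑ y ∈ C, w x * w y * #(S x ∩ S y) := by
  simp_rw [card_inter_eq_sum_indicator, sq, sum_mul_sum, mul_sum]
  rw [sum_comm]
  refine sum_congr rfl fun x _ => ?_
  rw [sum_comm]
  refine sum_congr rfl fun y _ => sum_congr rfl fun i _ => ?_
  ring

variable {C : Finset ι} {S : ι → Finset α} {k : ℕ}

namespace SymmDiffEquidistant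

theorem two_mul_card_inter [DecidableEq ι] (h : SymmDiffEquidistant C S k) {x y : ι}
    (hx : x ∈ C) (hy : y ∈ C) :
    (2 * #(S x ∩ S y) : ℤ) = #(S x) + #(S y) - 2 * k + (if x = y then 2 * (k : ℤ) else 0) := by
  split_ifs with hxy
  · subst hxy
    rw [inter_self]
    ring
  · have := h x hx y hy hxy
    push_cast [← @Nat.cast_inj ℤ] at this
    linarith

theorem disjoint_of_card_eq (h : SymmDiffEquidistant C S k) {x y : ι} (hx : x ∈ C) (hy : y ∈ C)
    (hxy : x ≠ y) (hxk : #(S x) = k) (hyk : #(S y) = k) : Disjoint (S x) (S y) := by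
  have := h x hx y hy hxy
  rw [disjoint_iff_inter_eq_empty, ← card_eq_zero]
  omega

theorem card_filter_card_eq_le (h : SymmDiffEquidistant C S k) {y : ι} (hy : y ∈ C)
    (hyk : k < #(S y)) :
    #{x ∈ C | #(S x) = k} ≤ k + 2 := by
  set L := {x ∈ C | #(S x) = k}
  obtain hempty | ⟨x₀, hx₀⟩ := L.eq_empty_or_nonempty
  · simp [hempty]
  have hdist : ∀ x ∈ L, #(S y) = k + 2 * #(S x ∩ S y) := by
    intro x hx
    obtain ⟨hxC, hxk⟩ := mem_filter.1 hx
    have := h x hxC y hy (by rintro rfl; omega)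
    omega
  have hs₀ := hdist x₀ hx₀
  set s := #(S x₀ ∩ S y)
  have hle : #L * s ≤ #(S y) := by
    calc #L * s = ∑ x ∈ L, #(S x ∩ S y) := by
          rw [sum_const_nat fun x hx => ?_]
          have := hdist x hx
          omega
      _ = #(L.biUnion fun x => S x ∩ S y) := by
          refine (card_biUnion fun x hx z hz hxz => ?_).symm
          obtain ⟨hxC, hxk⟩ := mem_filter.1 hx
          obtain ⟨hzC, hzk⟩ := mem_filter.1 hz
          exact (h.disjoint_of_card_eq hxC hzC hxz hxk hzk).mono inter_subset_left
            inter_subset_left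
      _ ≤ #(S y) := card_le_card (biUnion_subset.2 fun _ _ => inter_subset_right)
  by_contra! hlt
  have : 1 ≤ s := by omega
  nlinarith

variable [Fintype α]

theorem two_mul_sum_sq (h : SymmDiffEquidistant C S k) (w : ι → ℤ) :
    2 * ∑ i, (∑ x ∈ C, w x * (if i ∈ S x then 1 else 0)) ^ 2 =
      2 * (∑ x ∈ C, w x) * (∑ x ∈ C, w x * #(S x)) - 2 * k * (∑ x ∈ C, w x) ^ 2
        + 2 * k * ∑ x ∈ C, w x ^ 2 := by
  classical
  have hpair : ∀ x ∈ C, ∀ y ∈ C, 2 * (w x * w y * #(S x ∩ S y)) =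
      w x * #(S x) * w y + w x * (w y * #(S y)) - 2 * k * (w x * w y)
        + (if x = y then 2 * k * (w x * w y) else 0) := by
    intro x hx y hy
    have := h.two_mul_card_inter hx hy
    split_ifs at this ⊢ <;> linear_combination (w x * w y) * this
  rw [sum_sq_weighted_degree, mul_sum]
  simp_rw [mul_sum (s := C) (a := (2 : ℤ))]
  rw [sum_congr rfl fun x hx => sum_congr rfl (hpair x hx)]
  simp only [sum_add_distrib, sum_sub_distrib, ← mul_sum, ← sum_mul, sum_ite_eq]
  rw [sum_ite_of_true (fun _ h => h)]
  simp only [← mul_sum, ← sq]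
  ring

/-- The difference of the two halves into which a point splits a regular simplex
is at least as long as its component along that point. -/
theorem degree_mul_le (h : SymmDiffEquidistant C S k) (i : α) :
    (#{x ∈ C | i ∈ S x} * (#C - #{x ∈ C | i ∈ S x}) : ℤ) ≤ k * #C := by
  set a : ℤ := (#{x ∈ C | i ∈ S x} : ℤ) with ha
  have ha0 : 0 ≤ a := by positivity
  have haC : a ≤ #C := by
    rw [ha]
    exact_mod_cast card_filter_le _ _
  set b : ℤ := #C - a with hb
  have hb' : (#{x ∈ C | i ∉ S x} : ℤ) = b := by
    have := card_filter_add_card_filter_not (s := C) (fun x => i ∈ S x)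
    push_cast [← @Nat.cast_inj ℤ] at this
    linarith
  have key := h.two_mul_sum_sq (fun x => if i ∈ S x then b else -a)
  have h1 : ∑ x ∈ C, (if i ∈ S x then b else -a) = 0 := by
    rw [sum_ite]
    simp only [sum_const, nsmul_eq_mul, hb', ← ha]
    ring
  have h2 : ∑ x ∈ C, (if i ∈ S x then b else -a) ^ 2 = a * b * #C := by
    simp only [ite_pow]
    rw [sum_ite]
    simp only [sum_const, nsmul_eq_mul, hb', ← ha]
    rw [show (#C : ℤ) = a + b by rw [hb]; ring]
    ring
  have h3 : ∑ x ∈ C, (if i ∈ S x then b else -a) * (if i ∈ S x then 1 else 0) = a * b := by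
    rw [sum_congr rfl (g := fun x => if i ∈ S x then b else 0)
      (fun x _ => by split_ifs <;> simp), ← sum_filter]
    simp [← ha]
  have h4 := single_le_sum (s := univ) (f := fun j =>
    (∑ x ∈ C, (if i ∈ S x then b else -a) * (if j ∈ S x then 1 else 0)) ^ 2)
    (fun _ _ => sq_nonneg _) (mem_univ i)
  simp only [h3] at h4
  rw [h1, h2] at key
  have h5 : (a * b) * (a * b) ≤ (a * b) * (k * #C) := by linarith
  rcases (mul_nonneg ha0 (show 0 ≤ b by linarith)).eq_or_lt with h0 | h0
  · rw [← h0]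
    positivity
  · exact le_of_mul_le_mul_left h5 h0

theorem degree_le (h : SymmDiffEquidistant C S k) (hM : k ^ 2 + k + 3 ≤ #C) {i : α}
    (hi : 2 * #{x ∈ C | i ∈ S x} ≤ #C) : #{x ∈ C | i ∈ S x} ≤ k + 1 := by
  have key := h.degree_mul_le i
  by_contra! hlt
  zify at hlt hi hM
  nlinarith [mul_nonneg (show (0 : ℤ) ≤ #{x ∈ C | i ∈ S x} - k - 2 by linarith)
    (show (0 : ℤ) ≤ #C - #{x ∈ C | i ∈ S x} - k - 2 by linarith), sq_nonneg ((k : ℤ) - 1)]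

theorem sum_card_mul_le (h : SymmDiffEquidistant C S k)
    (hdeg : ∀ i, #{x ∈ C | i ∈ S x} ≤ k + 1) :
    (∑ x ∈ C, (#(S x) : ℤ)) * (#C - k - 1) ≤ k * #C * (#C - 1) := by
  have key := h.two_mul_sum_sq (fun _ => 1)
  have hsum : ∑ x ∈ C, (#(S x) : ℤ) = ∑ i, (#{x ∈ C | i ∈ S x} : ℤ) := by
    have := sum_card_bipartiteAbove_eq_sum_card_bipartiteBelow (s := C) (t := univ)
      (fun x i => i ∈ S x)
    simp only [bipartiteAbove, bipartiteBelow, filter_univ_mem] at this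
    exact_mod_cast this
  have hle : ∑ i, (#{x ∈ C | i ∈ S x} : ℤ) ^ 2 ≤ (k + 1) * ∑ x ∈ C, (#(S x) : ℤ) := by
    rw [hsum, mul_sum]
    refine sum_le_sum fun i _ => ?_
    rw [sq]
    have : (#{x ∈ C | i ∈ S x} : ℤ) ≤ k + 1 := by exact_mod_cast hdeg i
    gcongr
  simp only [one_mul, sum_boole, one_pow, sum_const, nsmul_eq_mul, mul_one] at key
  linarith

theorem le_card (h : SymmDiffEquidistant C S k) (hM : k ^ 2 + k + 3 ≤ #C)
    (hdeg : ∀ i, #{x ∈ C | i ∈ S x} ≤ k + 1) {x : ι} (hx : x ∈ C) : k ≤ #(S x) := by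
  by_contra! hlt
  have hW := h.sum_card_mul_le hdeg
  classical
  have hlow : (#(C.erase x) : ℤ) * (2 * k - #(S x)) ≤ ∑ y ∈ C.erase x, (#(S y) : ℤ) := by
    rw [← nsmul_eq_mul]
    refine card_nsmul_le_sum _ _ _ fun y hy => ?_
    have := h x hx y (mem_of_mem_erase hy) (ne_of_mem_erase hy).symm
    omega
  rw [← add_sum_erase _ _ hx] at hW
  have hc : (#(C.erase x) : ℤ) = #C - 1 := by
    have := card_erase_add_one hx
    omega
  rw [hc] at hlow
  zify at hM hlt
  have hbig : (k : ℤ) * #C + (#C - 2) ≤ #(S x) + ∑ y ∈ C.erase x, (#(S y) : ℤ) := by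
    nlinarith [mul_nonneg (show (0 : ℤ) ≤ k - #(S x) - 1 by linarith)
      (show (0 : ℤ) ≤ #C - 2 by nlinarith)]
  have := mul_le_mul_of_nonneg_right hbig (show (0 : ℤ) ≤ #C - k - 1 by nlinarith)
  nlinarith

theorem card_eq (h : SymmDiffEquidistant C S k) (hM : k ^ 2 + k + 3 ≤ #C)
    (hdeg : ∀ i, #{x ∈ C | i ∈ S x} ≤ k + 1) {y : ι} (hy : y ∈ C) : #(S y) = k := by
  by_contra hne
  have hyk : k < #(S y) := lt_of_le_of_ne (h.le_card hM hdeg hy) (Ne.symm hne)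
  have hW := h.sum_card_mul_le hdeg
  have hf := h.card_filter_card_eq_le hy hyk
  have hsplit := card_filter_add_card_filter_not (s := C) (fun x => #(S x) = k)
  rw [← sum_filter_add_sum_filter_not C (fun x => #(S x) = k)] at hW
  have hlight : ∑ x ∈ C with #(S x) = k, (#(S x) : ℤ) = #{x ∈ C | #(S x) = k} * k := by
    rw [← nsmul_eq_mul, ← sum_const]
    exact sum_congr rfl fun x hx => by rw [(mem_filter.1 hx).2]
  rw [hlight] at hW
  have hheavy : ∀ c : ℤ, (∀ x ∈ C, #(S x) ≠ k → c ≤ #(S x)) →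
      (#{x ∈ C | ¬ #(S x) = k} : ℤ) * c ≤ ∑ x ∈ C with ¬ #(S x) = k, (#(S x) : ℤ) := by
    intro c hc
    rw [← nsmul_eq_mul]
    exact card_nsmul_le_sum _ _ _ fun x hx => hc x (mem_filter.1 hx).1 (mem_filter.1 hx).2
  set L := {x ∈ C | #(S x) = k}
  set H := {x ∈ C | ¬ #(S x) = k}
  zify at hM hf hsplit
  have hpos : (0 : ℤ) ≤ #C - k - 1 := by nlinarith
  obtain hempty | ⟨x₀, hx₀⟩ := L.eq_empty_or_nonempty
  · have hb := hheavy (k + 1) fun x hx hxk => by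
      have := h.le_card (by exact_mod_cast hM) hdeg hx
      omega
    simp only [hempty, card_empty, Nat.cast_zero, zero_add, zero_mul] at hW hsplit
    rw [hsplit] at hb
    nlinarith [mul_le_mul_of_nonneg_right hb hpos]
  · obtain ⟨hx₀C, hx₀k⟩ := mem_filter.1 hx₀
    have hb := hheavy (k + 2) fun x hx hxk => by
      have := h.le_card (by exact_mod_cast hM) hdeg hx
      have := h x₀ hx₀C x hx (by rintro rfl; exact hxk hx₀k)
      omega
    have hb' : (#C : ℤ) * k + 2 * (#C - k - 2) ≤ #L * k + ∑ x ∈ H, (#(S x) : ℤ) := by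
      nlinarith
    have := mul_le_mul_of_nonneg_right hb' hpos
    obtain ⟨e, he⟩ : ∃ e : ℤ, (#C : ℤ) = k ^ 2 + k + 3 + e := ⟨_, (add_sub_cancel _ _).symm⟩
    have he0 : 0 ≤ e := by linarith
    rw [he] at this hW
    have hk0 : (0 : ℤ) ≤ k := by positivity
    nlinarith [mul_nonneg he0 (sq_nonneg (k : ℤ)), sq_nonneg e,
      mul_nonneg (sq_nonneg (k : ℤ)) (sq_nonneg ((k : ℤ) - 1)), pow_nonneg hk0 3]

/-- A large equidistant family in which every point is covered at most half of the time
consists of pairwise disjoint sets of size `k`. -/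
theorem card_mul_le (h : SymmDiffEquidistant C S k) (hM : k ^ 2 + k + 3 ≤ #C)
    (hhalf : ∀ i, 2 * #{x ∈ C | i ∈ S x} ≤ #C) : #C * k ≤ Fintype.card α := by
  have hk : ∀ x ∈ C, #(S x) = k := fun x hx => h.card_eq hM (fun i => h.degree_le hM (hhalf i)) hx
  rw [← sum_const_nat hk, ← card_biUnion fun x hx y hy hxy =>
    h.disjoint_of_card_eq hx hy hxy (hk x hx) (hk y hy)]
  exact card_le_univ _

end SymmDiffEquidistant

theorem card_filter_ne_add_card_filter_ne [Fintype α] (c x y : α → Fin 2) :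
    #{i | x i ≠ c i} + #{i | y i ≠ c i} =
      hammingDist x y + 2 * #(({i | x i ≠ c i} : Finset α) ∩ ({i | y i ≠ c i} : Finset α)) := by
  rw [hammingDist, ← filter_and]
  simp only [card_filter, mul_sum, ← sum_add_distrib]
  refine sum_congr rfl fun i _ => ?_
  generalize x i = a
  generalize y i = b
  generalize c i = e
  revert a b e
  decide

theorem exists_two_mul_card_filter_ne_le {ι : Type*} (C : Finset ι) (f : ι → Fin 2) :
    ∃ c : Fin 2, 2 * #{x ∈ C | f x ≠ c} ≤ #C := by
  have hsplit := card_filter_add_card_filter_not (s := C) (fun x => f x ≠ 0)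
  by_cases h0 : 2 * #{x ∈ C | f x ≠ 0} ≤ #C
  · exact ⟨0, h0⟩
  · refine ⟨1, ?_⟩
    have : {x ∈ C | f x ≠ 1} = {x ∈ C | ¬ f x ≠ 0} := by
      refine filter_congr fun x _ => ?_
      generalize f x = a
      revert a
      decide
    rw [this]
    omega

theorem card_mul_le_of_hammingDist_eq [Fintype α] {k : ℕ} {C : Finset (α → Fin 2)}
    (hC : ∀ x ∈ C, ∀ y ∈ C, x ≠ y → hammingDist x y = 2 * k) (hM : k ^ 2 + k + 3 ≤ #C) :
    #C * k ≤ Fintype.card α := by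
  choose c hc using fun i : α => exists_two_mul_card_filter_ne_le C (fun x => x i)
  have h : SymmDiffEquidistant C (fun x => ({i | x i ≠ c i} : Finset α)) k := by
    intro x hx y hy hxy
    rw [← hC x hx y hy hxy]
    exact card_filter_ne_add_card_filter_ne c x y
  exact h.card_mul_le hM fun i => by simpa using hc i

end

/-- A binary equidistant code with even distance `d > 0` has at most
`max {(d² + 2d + 8)/4, ⌊2n/d⌋}` codewords; in particular, if `n ≥ d(d² + 2d + 8)/8`
then it has at most `⌊2n/d⌋` codewords. -/
theorem binary_equidistant_card_le (n d : ℕ) (hd : Even d) (hd0 : 0 < d)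
    (C : Finset (Fin n → Fin 2))
    (hC : ∀ x ∈ C, ∀ y ∈ C, x ≠ y → hammingDist x y = d) :
    C.card ≤ max ((d ^ 2 + 2 * d + 8) / 4) (2 * n / d) ∧
      ((d : ℝ) * ((d : ℝ) ^ 2 + 2 * d + 8) / 8 ≤ (n : ℝ) → C.card ≤ 2 * n / d) := by
  obtain ⟨k, rfl⟩ := hd.two_dvd
  have hk : 0 < k := by omega
  have hdiv : ((2 * k) ^ 2 + 2 * (2 * k) + 8) / 4 = k ^ 2 + k + 2 := by
    rw [show (2 * k) ^ 2 + 2 * (2 * k) + 8 = 4 * (k ^ 2 + k + 2) by ring]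
    exact Nat.mul_div_cancel_left _ (by norm_num)
  rw [hdiv, Nat.mul_div_mul_left _ _ (by norm_num)]
  have hor : #C ≤ k ^ 2 + k + 2 ∨ #C ≤ n / k := by
    refine (le_or_gt #C (k ^ 2 + k + 2)).imp_right fun hM => ?_
    rw [Nat.le_div_iff_mul_le hk]
    simpa using card_mul_le_of_hammingDist_eq hC hM
  refine ⟨le_max_iff.2 hor, fun hn => hor.elim (fun hle => hle.trans ?_) id⟩
  rw [Nat.le_div_iff_mul_le hk]
  have : ((k ^ 2 + k + 2 : ℕ) * k : ℝ) ≤ n := by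
    refine le_trans (le_of_eq ?_) hn
    push_cast
    ring
  exact_mod_cast this
end

section
/- Let q ≥ 2 and let F ⊆ H_q^n be a set of words all of Hamming weight k, such that any two distinct words of F are at Hamming distance exactly d, where 0 < d ≤ 2k. If |F| > max{2(k − d/2) + 2, d² + d + 1, q − 1} (equivalently, |F| > max{2k − d + 2, d² + d + 1, q − 1}), then d is even and F is a Δ_q(n, k, k − d/2)-system; consequently |F| ≤ (n − (k − d/2))/(d/2). -/
/-- A `Δ_q(n,k,l)`-system with kernel `D` of size `l`: a constant-weight-`k` code in
`H_q^n` such that any two distinct codewords agree and are nonzero on `D`, and their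
supports are pairwise disjoint outside `D`. -/
def IsDeltaSystemQ (n q k l : ℕ) [NeZero q] (C : Finset (Fin n → Fin q)) : Prop :=
  (∀ x ∈ C, (Finset.univ.filter fun i => x i ≠ 0).card = k) ∧
    ∃ D : Finset (Fin n), D.card = l ∧
      (∀ x ∈ C, ∀ y ∈ C, x ≠ y → ∀ i ∈ D, x i = y i ∧ x i ≠ 0) ∧
      ∀ x ∈ C, ∀ y ∈ C, x ≠ y →
        Disjoint ((Finset.univ.filter fun i => x i ≠ 0) \ D)
          ((Finset.univ.filter fun i => y i ≠ 0) \ D)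

namespace Deza

open Finset

variable {α : Type*} [DecidableEq α]

theorem sum_card_inter_eq_sum_degree (s : Finset α) (B : Finset (Finset α)) :
    ∑ t ∈ B, #(s ∩ t) = ∑ a ∈ s, #{b ∈ B | a ∈ b} := by
  simp only [← filter_mem_eq_inter, card_filter]
  exact sum_comm

theorem card_symmDiff_add_two_mul_card_inter (s t : Finset α) :
    #(symmDiff s t) + 2 * #(s ∩ t) = #s + #t := by
  have h1 : #(symmDiff s t) = #(s \ t) + #(t \ s) := by
    rw [symmDiff_def, sup_eq_union, card_union_of_disjoint disjoint_sdiff_sdiff]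
  have h2 := card_sdiff_add_card_inter s t
  have h3 := card_sdiff_add_card_inter t s
  rw [inter_comm t s] at h3
  omega

/-- In a family of sets of constant size with constant pairwise intersection size, the degree `t`
of a point satisfies `t (N - t) < m N`. -/
theorem degree_mul_lt [Fintype α] {F : Finset (Finset α)} {m L : ℕ} (hm : 0 < m)
    (hF : F.Nonempty) (hcard : ∀ x ∈ F, #x = m + L)
    (hinter : ∀ x ∈ F, ∀ y ∈ F, x ≠ y → #(x ∩ y) = L) (i : α) :
    #{x ∈ F | i ∈ x} * #{x ∈ F | i ∉ x} < m * #F := by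
  have hN : #{x ∈ F | i ∈ x} + #{x ∈ F | i ∉ x} = #F := card_filter_add_card_filter_not _
  set t := #{x ∈ F | i ∈ x} with ht
  set s := #{x ∈ F | i ∉ x} with hs
  have hNpos : 0 < #F := hF.card_pos
  rcases Nat.eq_zero_or_pos (t * s) with h0 | hpos
  · rw [h0]; positivity
  let c : Finset α → ℤ := fun x => if i ∈ x then s else -t
  let f : α → ℤ := fun j => ∑ x ∈ F, if j ∈ x then c x else 0
  have hc : ∑ x ∈ F, c x = 0 := by
    simp only [c, sum_ite, sum_const, ← ht, ← hs, nsmul_eq_mul]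
    ring
  have hc2 : ∑ x ∈ F, c x * c x = (t * s * #F : ℤ) := by
    have : ∀ x, c x * c x = if i ∈ x then (s * s : ℤ) else t * t := by
      intro x; simp only [c]; split_ifs <;> ring
    simp only [this, sum_ite, sum_const, ← ht, ← hs, nsmul_eq_mul, ← hN]
    push_cast; ring
  have hfi : f i = t * s := by
    have : ∀ x, (if i ∈ x then c x else 0) = if i ∈ x then (s : ℤ) else 0 := by
      intro x; simp only [c]; split_ifs <;> rfl
    simp only [f]
    rw [sum_congr rfl fun x _ => this x, ← sum_filter, sum_const, ← ht, nsmul_eq_mul]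
  have hfsum : ∑ j, f j = 0 := by
    simp only [f]
    rw [sum_comm]
    have : ∀ x ∈ F, (∑ j, if j ∈ x then c x else 0) = (m + L : ℤ) * c x := by
      intro x hx
      rw [← sum_filter]
      simp [hcard x hx]
    rw [sum_congr rfl this, ← mul_sum, hc, mul_zero]
  have hfsq : ∑ j, f j * f j = m * (t * s * #F : ℤ) := by
    have h1 : ∑ j, f j * f j = ∑ x ∈ F, ∑ y ∈ F, c x * c y * #(x ∩ y) := by
      simp only [f, sum_mul_sum]
      rw [sum_comm]
      refine sum_congr rfl fun x _ => ?_
      rw [sum_comm]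
      refine sum_congr rfl fun y _ => ?_
      have : ∀ j, (if j ∈ x then c x else 0) * (if j ∈ y then c y else 0)
          = if j ∈ x ∩ y then c x * c y else 0 := by
        intro j; simp only [mem_inter]; split_ifs <;> simp_all
      rw [sum_congr rfl fun j _ => this j, ← sum_filter, filter_univ_mem, sum_const,
        nsmul_eq_mul, mul_comm]
    have h2 : ∀ x ∈ F, ∑ y ∈ F, c x * c y * #(x ∩ y) = m * (c x * c x) := by
      intro x hx
      have : ∀ y ∈ F, c x * c y * (#(x ∩ y) : ℤ)
          = L * c x * c y + if x = y then m * (c x * c x) else 0 := by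
        intro y hy
        split_ifs with h
        · subst h
          rw [inter_self, hcard x hx]; push_cast; ring
        · rw [hinter x hx y hy h]; ring
      rw [sum_congr rfl this, sum_add_distrib, ← mul_sum, hc]
      simp [hx]
    rw [h1, sum_congr rfl h2, ← mul_sum, hc2]
  have hposZ : (0 : ℤ) < t * s := by exact_mod_cast hpos
  obtain ⟨j, hj, hfj⟩ : ∃ j, j ≠ i ∧ f j ≠ 0 := by
    by_contra! h
    have := sum_eq_single i (s := univ) (f := f) (fun j _ hj => h j hj) (by simp)
    rw [hfsum, hfi] at this
    omega
  have hlt : f i * f i < ∑ j, f j * f j :=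
    single_lt_sum (f := fun j => f j * f j) hj (mem_univ i) (mem_univ j) (mul_self_pos.2 hfj)
      fun k _ _ => mul_self_nonneg _
  rw [hfi, hfsq] at hlt
  have : (t * s : ℤ) < m * #F := by
    nlinarith
  exact_mod_cast this

theorem degree_le_of_mul_lt {m N s t : ℕ} (hm : 2 ≤ m) (hN : m ^ 2 + m + 2 ≤ N) (hst : t + s = N)
    (hts : t ≤ s) (h : t * s < m * N) : t ≤ m + 1 := by
  by_contra! hlt
  obtain ⟨a, rfl⟩ := Nat.exists_eq_add_of_le (show m + 2 ≤ t by omega)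
  obtain ⟨b, rfl⟩ := Nat.exists_eq_add_of_le (show m + 2 ≤ s by omega)
  subst hst
  nlinarith [Nat.zero_le (a * b)]

theorem sum_card_inter_erase_le {G : Finset (Finset α)} {m : ℕ}
    (hdeg : ∀ i, #{x ∈ G | i ∈ x} ≤ m + 1) {x : Finset α} (hx : x ∈ G) :
    ∑ y ∈ G.erase x, #(x ∩ y) ≤ #x * m := by
  have h1 := sum_card_inter_le (s := x) (B := G) (n := m + 1) fun i _ => hdeg i
  rw [← add_sum_erase _ _ hx, inter_self] at h1
  linarith

/-- The exceptional configuration (a projective plane of order `m` together with a disjoint set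
of size `m - 1`) is not, up to a symmetric difference, a family of sets of constant size. -/
theorem le_card_of_equidistant {G : Finset (Finset α)} {m e K : ℕ} (E : Finset α) (hm : 2 ≤ m)
    (hN : m ^ 2 + m + 2 ≤ #G) (hdeg : ∀ i, #{x ∈ G | i ∈ x} ≤ m + 1)
    (hdist : ∀ x ∈ G, ∀ y ∈ G, x ≠ y → #x + #y = 2 * m + 2 * #(x ∩ y))
    (hE : ∀ x ∈ G, #x + e = K + 2 * #(E ∩ x)) {x₀ : Finset α} (hx₀ : x₀ ∈ G) : m ≤ #x₀ := by
  by_contra! hlt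
  have hH : #(G.erase x₀) = #G - 1 := card_erase_of_mem hx₀
  have hge : ∀ y ∈ G.erase x₀, m + 1 ≤ #y := by
    intro y hy
    have := hdist x₀ hx₀ y (mem_of_mem_erase hy) (ne_of_mem_erase hy).symm
    omega
  have hbound : ∀ x ∈ G.erase x₀,
      ∑ y ∈ (G.erase x₀).erase x, #(x ∩ y) + #(x ∩ x₀) ≤ #x * m := by
    intro x hx
    have h1 := sum_card_inter_erase_le hdeg (mem_of_mem_erase hx)
    rwa [← add_sum_erase _ _ (mem_erase.2 ⟨(ne_of_mem_erase hx).symm, hx₀⟩), erase_right_comm,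
      add_comm] at h1
  have hcardHx : ∀ x ∈ G.erase x₀, #((G.erase x₀).erase x) = #G - 2 := by
    intro x hx
    rw [card_erase_of_mem hx, hH]; omega
  obtain ⟨x, hx, hmin⟩ := exists_min_image (G.erase x₀) card (card_pos.1 (by omega))
  have hxa : #x = m + 1 := by
    obtain ⟨a, ha⟩ := Nat.exists_eq_add_of_le (hge x hx)
    have h1 : #((G.erase x₀).erase x) • (a + 1) ≤ ∑ y ∈ (G.erase x₀).erase x, #(x ∩ y) := by
      refine card_nsmul_le_sum _ _ _ fun y hy => ?_
      have hy' := mem_of_mem_erase hy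
      have := hdist x (mem_of_mem_erase hx) y (mem_of_mem_erase hy') (ne_of_mem_erase hy).symm
      have := hmin y hy'
      omega
    have h2 := hbound x hx
    rw [hcardHx x hx, smul_eq_mul] at h1
    obtain ⟨N, hN'⟩ := Nat.exists_eq_add_of_le hN
    have h3 : #G - 2 = m ^ 2 + m + N := by omega
    rw [h3] at h1
    rw [ha] at h2
    have : a = 0 := by
      by_contra h
      have : 1 ≤ a := by omega
      nlinarith [Nat.zero_le (a * N)]
    omega
  have hone : ∀ x ∈ G.erase x₀, #x = m + 1 → ∀ y ∈ (G.erase x₀).erase x, 1 ≤ #(x ∩ y) := by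
    intro x hx hxa y hy
    have hy' := mem_of_mem_erase hy
    have := hdist x (mem_of_mem_erase hx) y (mem_of_mem_erase hy') (ne_of_mem_erase hy).symm
    have := hge y hy'
    omega
  have hsum : ∀ x ∈ G.erase x₀, #x = m + 1 →
      m ^ 2 + m ≤ ∑ y ∈ (G.erase x₀).erase x, #(x ∩ y) := by
    intro x hx hxa
    have h1 := card_nsmul_le_sum _ _ _ (hone x hx hxa)
    rw [hcardHx x hx, smul_eq_mul] at h1
    omega
  have hx0 : #(x ∩ x₀) = 0 := by
    have h1 := hbound x hx
    have h2 := hsum x hx hxa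
    rw [hxa] at h1
    nlinarith
  have hNeq : #G = m ^ 2 + m + 2 := by
    have h1 := hbound x hx
    have h2 := card_nsmul_le_sum _ _ _ (hone x hx hxa)
    rw [hcardHx x hx, smul_eq_mul] at h2
    rw [hxa] at h1
    have : #G - 2 ≤ m ^ 2 + m := by nlinarith
    omega
  have hx0card : #x₀ + 1 = m := by
    have := hdist x (mem_of_mem_erase hx) x₀ hx₀ (ne_of_mem_erase hx)
    omega
  have hall : ∀ y ∈ G.erase x₀, #y = m + 1 := by
    intro y hy
    by_cases hxy : y = x
    · rw [hxy, hxa]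
    have hy' : y ∈ (G.erase x₀).erase x := mem_erase.2 ⟨hxy, hy⟩
    have h1 : ∑ y ∈ (G.erase x₀).erase x, 1 = ∑ y ∈ (G.erase x₀).erase x, #(x ∩ y) := by
      refine le_antisymm (sum_le_sum (hone x hx hxa)) ?_
      have h1 := hbound x hx
      rw [hxa] at h1
      rw [← card_eq_sum_ones, hcardHx x hx, hNeq]
      have : m ^ 2 + m + 2 - 2 = m ^ 2 + m := by omega
      nlinarith
    have h2 := (sum_eq_sum_iff_of_le (hone x hx hxa)).1 h1 y hy'
    have := hdist x (mem_of_mem_erase hx) y (mem_of_mem_erase hy) (Ne.symm hxy)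
    omega
  have hdisj : ∀ y ∈ G.erase x₀, #(y ∩ x₀) = 0 := by
    intro y hy
    have := hdist y (mem_of_mem_erase hy) x₀ hx₀ (ne_of_mem_erase hy)
    have := hall y hy
    omega
  have hdegeq : ∀ y ∈ G.erase x₀, ∀ i ∈ y, #{z ∈ G | i ∈ z} = m + 1 := by
    intro y hy
    have h1 : ∑ i ∈ y, #{z ∈ G | i ∈ z} = ∑ i ∈ y, (m + 1) := by
      refine le_antisymm (sum_le_sum fun i _ => hdeg i) ?_
      rw [← sum_card_inter_eq_sum_degree, ← add_sum_erase _ _ (mem_of_mem_erase hy),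
        ← add_sum_erase _ _ (mem_erase.2 ⟨(ne_of_mem_erase hy).symm, hx₀⟩), erase_right_comm,
        inter_self, sum_const, hall y hy, smul_eq_mul]
      have := hsum y hy (hall y hy)
      nlinarith
    exact (sum_eq_sum_iff_of_le fun i _ => hdeg i).1 h1
  have hdvd : m + 1 ∣ ∑ y ∈ G.erase x₀, #(E ∩ y) := by
    rw [sum_card_inter_eq_sum_degree]
    refine dvd_sum fun i _ => ?_
    by_cases h : ∃ y ∈ G.erase x₀, i ∈ y
    · obtain ⟨y, hy, hiy⟩ := h
      have hi : i ∉ x₀ := fun hi => by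
        have := card_eq_zero.1 (hdisj y hy)
        exact notMem_empty i (this ▸ mem_inter.2 ⟨hiy, hi⟩)
      rw [filter_erase, erase_eq_of_notMem (by simp [hi]), hdegeq y hy i hiy]
    · push Not at h
      rw [filter_eq_empty_iff.2 (fun y hy => h y hy)]
      simp
  have hconst : ∀ y ∈ G.erase x₀, #(E ∩ y) = #(E ∩ x₀) + 1 := by
    intro y hy
    have := hE y (mem_of_mem_erase hy)
    have := hE x₀ hx₀
    have := hall y hy
    omega
  rw [sum_congr rfl hconst, sum_const, hH, hNeq, smul_eq_mul,
    show m ^ 2 + m + 2 - 1 = m * (m + 1) + 1 by ring_nf; omega] at hdvd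
  have hcop : Nat.Coprime (m + 1) (m * (m + 1) + 1) := by simp
  have h1 := Nat.le_of_dvd (by omega) (hcop.dvd_of_dvd_mul_left hdvd)
  have h2 : #(E ∩ x₀) ≤ #x₀ := card_le_card inter_subset_right
  omega

theorem card_eq_of_equidistant {G : Finset (Finset α)} {m e K : ℕ} (E : Finset α) (hm : 2 ≤ m)
    (hN : m ^ 2 + m + 2 ≤ #G) (hdeg : ∀ i, #{x ∈ G | i ∈ x} ≤ m + 1)
    (hdist : ∀ x ∈ G, ∀ y ∈ G, x ≠ y → #x + #y = 2 * m + 2 * #(x ∩ y))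
    (hE : ∀ x ∈ G, #x + e = K + 2 * #(E ∩ x)) : ∀ x ∈ G, #x = m := by
  have hge : ∀ x ∈ G, m ≤ #x := fun x hx => le_card_of_equidistant E hm hN hdeg hdist hE hx
  obtain ⟨N, hN'⟩ := Nat.exists_eq_add_of_le hN
  have hcard : ∀ x ∈ G, #(G.erase x) = m ^ 2 + m + 1 + N := by
    intro x hx
    rw [card_erase_of_mem hx]; omega
  obtain ⟨x, hx, hmin⟩ := exists_min_image G card (card_pos.1 (by omega))
  have hxm : #x = m := by
    obtain ⟨a, ha⟩ := Nat.exists_eq_add_of_le (hge x hx)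
    have h1 : #(G.erase x) • a ≤ ∑ y ∈ G.erase x, #(x ∩ y) := by
      refine card_nsmul_le_sum _ _ _ fun y hy => ?_
      have := hdist x hx y (mem_of_mem_erase hy) (ne_of_mem_erase hy).symm
      have := hmin y (mem_of_mem_erase hy)
      omega
    have h2 := sum_card_inter_erase_le hdeg hx
    rw [hcard x hx, smul_eq_mul] at h1
    rw [ha] at h2
    have : a = 0 := by
      by_contra h
      have : 1 ≤ a := by omega
      nlinarith [Nat.zero_le (a * N)]
    omega
  have htwo : ∀ y ∈ G, #y ≠ m → #y = m + 2 := by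
    intro y hy hym
    have hxy : x ≠ y := fun h => hym (h ▸ hxm)
    have h0 := hdist x hx y hy hxy
    have hc : #y = m + 2 * #(x ∩ y) := by omega
    set c := #(x ∩ y)
    have h1 : #(G.erase y) • c ≤ ∑ z ∈ G.erase y, #(y ∩ z) := by
      refine card_nsmul_le_sum _ _ _ fun z hz => ?_
      have := hdist y hy z (mem_of_mem_erase hz) (ne_of_mem_erase hz).symm
      have := hge z (mem_of_mem_erase hz)
      omega
    have h2 := sum_card_inter_erase_le hdeg hy
    rw [hcard y hy, smul_eq_mul] at h1
    rw [hc] at h2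
    have : c < 2 := by
      by_contra! h
      obtain ⟨a, rfl⟩ := Nat.exists_eq_add_of_le hm
      obtain ⟨b, hb⟩ := Nat.exists_eq_add_of_le h
      rw [hb] at h1 h2
      nlinarith [Nat.zero_le (b * N), Nat.zero_le (a * b), Nat.zero_le (a * a * b)]
    omega
  intro y hy
  by_contra hym
  have hy2 := htwo y hy hym
  set P := {z ∈ G | #z = m} with hP
  have hPsum : ∑ z ∈ P, #(y ∩ z) = #P := by
    rw [card_eq_sum_ones]
    refine sum_congr rfl fun z hz => ?_
    obtain ⟨hz, hzm⟩ := mem_filter.1 hz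
    have := hdist y hy z hz (by rintro rfl; exact hym hzm)
    omega
  have hPle : #P ≤ m + 2 := by
    rw [← hPsum, ← hy2, ← mul_one #y]
    refine sum_card_inter_le fun i _ => card_le_one.2 ?_
    intro a ha b hb
    simp only [hP, mem_filter] at ha hb
    by_contra hab
    have h1 := hdist a ha.1.1 b hb.1.1 hab
    have h2 : 0 < #(a ∩ b) := card_pos.2 ⟨i, mem_inter.2 ⟨ha.2, hb.2⟩⟩
    omega
  have h1 : ∑ z ∈ G.erase y, 2 ≤ ∑ z ∈ G.erase y, (#(y ∩ z) + if #z = m then 1 else 0) := by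
    refine sum_le_sum fun z hz => ?_
    have h := hdist y hy z (mem_of_mem_erase hz) (ne_of_mem_erase hz).symm
    split_ifs with hzm
    · omega
    · have := htwo z (mem_of_mem_erase hz) hzm
      omega
  have h2 : ∑ z ∈ G.erase y, (if #z = m then 1 else 0) ≤ #P := by
    rw [← card_filter]
    exact card_le_card (filter_subset_filter _ (erase_subset _ _))
  have h3 := sum_card_inter_erase_le hdeg hy
  rw [sum_add_distrib, sum_const, smul_eq_mul, hcard y hy] at h1
  rw [hy2] at h3
  nlinarith

/-- **Deza's theorem**: a large family of sets of size `m + L` whose pairwise intersections all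
have size `L` is a sunflower. -/
theorem exists_kernel [Fintype α] {F : Finset (Finset α)} {m L : ℕ} (hm : 0 < m)
    (hcard : ∀ x ∈ F, #x = m + L)
    (hinter : ∀ x ∈ F, ∀ y ∈ F, x ≠ y → #(x ∩ y) = L)
    (hL : L + 2 < #F) (hN : m ^ 2 + m + 1 < #F) :
    ∃ E : Finset α, #E = L ∧ ∀ x ∈ F, ∀ y ∈ F, x ≠ y → x ∩ y = E := by
  let E : Finset α := {i | #F < 2 * #{x ∈ F | i ∈ x}}
  have hinj : Function.Injective fun x : Finset α => symmDiff x E :=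
    symmDiff_left_injective E
  let G := F.image fun x => symmDiff x E
  have hGcard : #G = #F := card_image_of_injective _ hinj
  have hdegG : ∀ i, ∃ s, #{x ∈ G | i ∈ x} + s = #F ∧ #{x ∈ G | i ∈ x} ≤ s ∧
      #{x ∈ G | i ∈ x} * s < m * #F := by
    intro i
    have h1 := degree_mul_lt hm (card_pos.1 (by omega)) hcard hinter i
    have h2 : #{x ∈ F | i ∈ x} + #{x ∈ F | i ∉ x} = #F := card_filter_add_card_filter_not _
    have h3 : #{x ∈ G | i ∈ x} = #{x ∈ F | i ∈ symmDiff x E} := by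
      rw [filter_image, card_image_of_injective _ hinj]
    rw [h3]
    by_cases hi : i ∈ E
    · refine ⟨#{x ∈ F | i ∈ x}, ?_⟩
      have h4 : #F < 2 * #{x ∈ F | i ∈ x} := by simpa [E] using hi
      simp only [mem_symmDiff, hi, not_true_eq_false, and_false, false_or, true_and]
      exact ⟨by omega, by omega, by rwa [mul_comm]⟩
    · refine ⟨#{x ∈ F | i ∉ x}, ?_⟩
      have h4 : ¬ #F < 2 * #{x ∈ F | i ∈ x} := by simpa [E] using hi
      simp only [mem_symmDiff, hi, not_false_eq_true, and_true, false_and, or_false]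
      exact ⟨by omega, by omega, h1⟩
  have hdistG : ∀ x ∈ G, ∀ y ∈ G, x ≠ y → #x + #y = 2 * m + 2 * #(x ∩ y) := by
    simp only [G, forall_mem_image]
    intro x hx y hy hxy
    have hne : x ≠ y := fun h => hxy (h ▸ rfl)
    have h1 := card_symmDiff_add_two_mul_card_inter (symmDiff x E) (symmDiff y E)
    have h2 := card_symmDiff_add_two_mul_card_inter x y
    rw [symmDiff_symmDiff_symmDiff_comm, symmDiff_self, symmDiff_bot] at h1
    rw [hcard x hx, hcard y hy, hinter x hx y hy hne] at h2
    omega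
  have hEG : ∀ x ∈ G, #x + #E = (m + L) + 2 * #(E ∩ x) := by
    simp only [G, forall_mem_image]
    intro x hx
    have h1 := card_symmDiff_add_two_mul_card_inter (symmDiff x E) E
    rw [symmDiff_symmDiff_cancel_right, hcard x hx, inter_comm] at h1
    omega
  have hGm : ∀ x ∈ G, ∀ y ∈ G, x ≠ y → #x = m ∧ Disjoint x y := by
    rcases Nat.lt_or_ge m 2 with hm1 | hm2
    · obtain rfl : m = 1 := by omega
      have hdeg1 : ∀ i, #{x ∈ G | i ∈ x} ≤ 1 := by
        intro i
        obtain ⟨s, h1, h2, h3⟩ := hdegG i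
        by_contra! h
        obtain ⟨a, ha⟩ := Nat.exists_eq_add_of_le h
        obtain ⟨b, hb⟩ := Nat.exists_eq_add_of_le h2
        rw [ha] at h1 hb h3
        subst hb
        nlinarith [Nat.zero_le (a * b)]
      have hdisj : ∀ x ∈ G, ∀ y ∈ G, x ≠ y → Disjoint x y := by
        intro x hx y hy hxy
        rw [disjoint_left]
        intro i hix hiy
        exact hxy (card_le_one.1 (hdeg1 i) x (by simp [hx, hix]) y (by simp [hy, hiy]))
      intro x hx y hy hxy
      refine ⟨?_, hdisj x hx y hy hxy⟩
      obtain ⟨z, hz, hzxy⟩ : ∃ z ∈ G, z ∉ ({x, y} : Finset (Finset α)) :=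
        exists_mem_notMem_of_card_lt_card (by have := card_le_two (a := x) (b := y); omega)
      simp only [mem_insert, mem_singleton, not_or] at hzxy
      have h1 := hdistG x hx y hy hxy
      have h2 := hdistG z hz x hx hzxy.1
      have h3 := hdistG z hz y hy hzxy.2
      rw [disjoint_iff_inter_eq_empty.1 (hdisj _ hx _ hy hxy), card_empty] at h1
      rw [disjoint_iff_inter_eq_empty.1 (hdisj _ hz _ hx hzxy.1), card_empty] at h2
      rw [disjoint_iff_inter_eq_empty.1 (hdisj _ hz _ hy hzxy.2), card_empty] at h3
      omega
    · have hall : ∀ x ∈ G, #x = m := by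
        refine card_eq_of_equidistant E hm2 (by omega) (fun i => ?_) hdistG hEG
        obtain ⟨s, h1, h2, h3⟩ := hdegG i
        exact degree_le_of_mul_lt hm2 (by omega) h1 h2 h3
      intro x hx y hy hxy
      refine ⟨hall x hx, ?_⟩
      have := hdistG x hx y hy hxy
      rw [hall x hx, hall y hy] at this
      rw [disjoint_iff_inter_eq_empty, ← card_eq_zero]
      omega
  have hGcard_eq : ∀ x ∈ G, #x = m := by
    intro x hx
    obtain ⟨y, hy, hxy⟩ := exists_mem_ne (s := G) (by omega) x
    exact (hGm x hx y hy hxy.symm).1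
  have hEempty : ∀ x ∈ G, #(E ∩ x) = 0 := by
    intro x hx
    by_contra hne
    have hsum : ∑ y ∈ G, #(E ∩ y) ≤ #E * 1 := by
      refine sum_card_inter_le fun i _ => card_le_one.2 ?_
      intro a ha b hb
      simp only [mem_filter] at ha hb
      by_contra hab
      exact disjoint_left.1 (hGm a ha.1 b hb.1 hab).2 ha.2 hb.2
    have hconst : ∀ y ∈ G, #(E ∩ y) = #(E ∩ x) := by
      intro y hy
      have := hEG x hx
      have := hEG y hy
      have := hGcard_eq x hx
      have := hGcard_eq y hy
      omega
    rw [sum_congr rfl hconst, sum_const, smul_eq_mul, hGcard] at hsum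
    have h1 := hEG x hx
    have h2 := hGcard_eq x hx
    have : 1 ≤ #(E ∩ x) := by omega
    nlinarith
  have hEL : #E = L := by
    obtain ⟨x, hx⟩ := card_pos.1 (show 0 < #G by omega)
    have := hEG x hx
    have := hGcard_eq x hx
    have := hEempty x hx
    omega
  have hsub : ∀ x ∈ F, E ⊆ x := by
    intro x hx i hi
    have h1 := card_eq_zero.1 (hEempty _ (mem_image_of_mem _ hx))
    by_contra hix
    exact notMem_empty i (h1 ▸ mem_inter.2 ⟨hi, mem_symmDiff.2 (Or.inr ⟨hi, hix⟩)⟩)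
  refine ⟨E, hEL, fun x hx y hy hxy => ?_⟩
  refine (eq_of_subset_of_card_le (subset_inter (hsub x hx) (hsub y hy)) ?_).symm
  rw [hinter x hx y hy hxy, hEL]

/-- The set attached to a word: a nonzero letter `a` at position `i` contributes the two points
`(i, 0)` and `(i, a)`. -/
def wordSet {n q : ℕ} [NeZero q] (x : Fin n → Fin q) : Finset (Fin n × Fin q) :=
  {p | x p.1 ≠ 0 ∧ (p.2 = 0 ∨ p.2 = x p.1)}

section Word

variable {n q : ℕ} [NeZero q]

theorem mem_wordSet {x : Fin n → Fin q} {p : Fin n × Fin q} :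
    p ∈ wordSet x ↔ x p.1 ≠ 0 ∧ (p.2 = 0 ∨ p.2 = x p.1) := by
  simp [wordSet]

theorem card_wordSet_inter_add_hammingDist (x y : Fin n → Fin q) :
    #(wordSet x ∩ wordSet y) + hammingDist x y = #{i | x i ≠ 0} + #{i | y i ≠ 0} := by
  have h : wordSet x ∩ wordSet y = ({p | x p.1 ≠ 0 ∧ y p.1 ≠ 0 ∧
      (p.2 = 0 ∨ (p.2 = x p.1 ∧ x p.1 = y p.1))} : Finset (Fin n × Fin q)) := by
    ext p
    simp only [mem_inter, mem_wordSet, mem_filter, mem_univ, true_and]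
    grind
  rw [h, hammingDist]
  simp only [card_filter, Fintype.sum_prod_type, ← sum_add_distrib]
  refine sum_congr rfl fun i _ => ?_
  rw [← card_filter]
  by_cases hx : x i = 0
  · by_cases hy : y i = 0 <;> simp [hx, hy, eq_comm]
  · by_cases hy : y i = 0
    · simp [hx, hy]
    · by_cases hxy : x i = y i
      · have : ({a | a = 0 ∨ a = y i} : Finset (Fin q)) = {0, y i} := by ext; simp
        simp [hy, hxy, this, card_pair (Ne.symm hy)]
      · simp [hx, hy, hxy, filter_eq']

theorem card_wordSet (x : Fin n → Fin q) : #(wordSet x) = 2 * #{i | x i ≠ 0} := by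
  have := card_wordSet_inter_add_hammingDist x x
  rw [inter_self, hammingDist_self] at this
  omega

theorem wordSet_injective : Function.Injective (wordSet : (Fin n → Fin q) → _) := by
  intro x y h
  have h1 := card_wordSet_inter_add_hammingDist x y
  have hx := card_wordSet x
  have hy := card_wordSet y
  rw [h, inter_self] at h1
  rw [h] at hx
  exact hammingDist_eq_zero.1 (by omega)

end Word

/-- A family of more than `2k - d + 2`, `d² + d + 1` and `q - 1` words of weight `k` with pairwise
distance `d` has a kernel on which all words agree, of size `k - d/2`. -/
theorem exists_word_kernel {n q k d : ℕ} [NeZero q] (hd0 : 0 < d) (hdk : d ≤ 2 * k)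
    {F : Finset (Fin n → Fin q)} (hw : ∀ x ∈ F, #{i | x i ≠ 0} = k)
    (hdist : ∀ x ∈ F, ∀ y ∈ F, x ≠ y → hammingDist x y = d)
    (h1 : 2 * k - d + 2 < #F) (h2 : d ^ 2 + d + 1 < #F) (h3 : q - 1 < #F) :
    ∃ D : Finset (Fin n), 2 * #D + d = 2 * k ∧
      (∀ x ∈ F, ∀ y ∈ F, ∀ i ∈ D, x i = y i ∧ x i ≠ 0) ∧
      ∀ x ∈ F, ∀ y ∈ F, x ≠ y → ∀ i, x i ≠ 0 → y i ≠ 0 → i ∈ D := by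
  have hFim : #(F.image wordSet) = #F := card_image_of_injective _ wordSet_injective
  obtain ⟨E, hEcard, hE⟩ := exists_kernel (F := F.image wordSet) (m := d) (L := 2 * k - d) hd0
    (by
      simp only [forall_mem_image]
      intro x hx
      rw [card_wordSet, hw x hx]; omega)
    (by
      simp only [forall_mem_image]
      intro x hx y hy hxy
      have := card_wordSet_inter_add_hammingDist x y
      rw [hw x hx, hw y hy, hdist x hx y hy (fun h => hxy (h ▸ rfl))] at this
      omega)
    (by omega) (by omega)
  replace hE : ∀ x ∈ F, ∀ y ∈ F, x ≠ y → wordSet x ∩ wordSet y = E := fun x hx y hy hxy =>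
    hE _ (mem_image_of_mem _ hx) _ (mem_image_of_mem _ hy) (wordSet_injective.ne hxy)
  have hsub : ∀ x ∈ F, E ⊆ wordSet x := by
    intro x hx
    obtain ⟨y, hy, hxy⟩ := exists_mem_ne (s := F) (by omega) x
    rw [← hE x hx y hy hxy.symm]
    exact inter_subset_left
  let D : Finset (Fin n) := {i | (i, (0 : Fin q)) ∈ E}
  have hD : ∀ i, i ∈ D ↔ (i, (0 : Fin q)) ∈ E := by simp [D]
  have hne : ∀ x ∈ F, ∀ i ∈ D, x i ≠ 0 := fun x hx i hi =>
    (mem_wordSet.1 (hsub x hx ((hD i).1 hi))).1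
  have hagree : ∀ x ∈ F, ∀ y ∈ F, ∀ i ∈ D, x i = y i := by
    intro x hx y hy i hi
    obtain ⟨a, ha, b, hb, hab, heq⟩ : ∃ a ∈ F, ∃ b ∈ F, a ≠ b ∧ a i = b i := by
      refine exists_ne_map_eq_of_card_lt_of_maps_to (t := univ.erase (0 : Fin q)) ?_
        (f := fun z : Fin n → Fin q => z i) fun z hz => by simpa using hne z hz i hi
      rw [card_erase_of_mem (mem_univ _), card_univ, Fintype.card_fin]
      exact h3
    have hiE : (i, a i) ∈ E := by
      rw [← hE a ha b hb hab, mem_inter, mem_wordSet, mem_wordSet]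
      exact ⟨⟨hne a ha i hi, Or.inr rfl⟩, hne b hb i hi, Or.inr heq⟩
    have hval : ∀ z ∈ F, a i = z i := fun z hz =>
      (mem_wordSet.1 (hsub z hz hiE)).2.resolve_left (hne a ha i hi)
    rw [← hval x hx, ← hval y hy]
  have hout : ∀ x ∈ F, ∀ y ∈ F, x ≠ y → ∀ i, x i ≠ 0 → y i ≠ 0 → i ∈ D := by
    intro x hx y hy hxy i hxi hyi
    rw [hD, ← hE x hx y hy hxy, mem_inter, mem_wordSet, mem_wordSet]
    exact ⟨⟨hxi, Or.inl rfl⟩, hyi, Or.inl rfl⟩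
  refine ⟨D, ?_, fun x hx y hy i hi => ⟨hagree x hx y hy i hi, hne x hx i hi⟩, hout⟩
  obtain ⟨x, hx⟩ := card_pos.1 (show 0 < #F by omega)
  obtain ⟨y, hy, hxy⟩ := exists_mem_ne (s := F) (by omega) x
  let z : Fin n → Fin q := fun i => if i ∈ D then x i else 0
  have hz : ∀ i, z i ≠ 0 ↔ i ∈ D := by
    intro i
    by_cases hi : i ∈ D <;> simp [z, hi, hne x hx]
  have hzE : wordSet z = E := by
    rw [← hE x hx y hy hxy.symm]
    ext ⟨i, a⟩
    simp only [mem_inter, mem_wordSet, hz]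
    by_cases hi : i ∈ D
    · simp [z, hi, hne x hx i hi, ← hagree x hx y hy i hi]
    · have := hout x hx y hy hxy.symm i
      tauto
  have := card_wordSet z
  simp only [hzE, hEcard, hz, filter_univ_mem] at this
  omega

end Deza

/-- `q`-ary version of Deza's theorem: a constant-weight-`k` equidistant code in `H_q^n`
with distance `0 < d ≤ 2k` and more than `max {2k - d + 2, d² + d + 1, q - 1}` codewords
has even distance `d`, forms a `Δ_q(n, k, k - d/2)`-system, and hence has at most
`(n - (k - d/2))/(d/2)` codewords. -/
theorem deza_theorem_qary (q n k d : ℕ) [NeZero q] (hq : 2 ≤ q)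
    (hd0 : 0 < d) (hdk : d ≤ 2 * k)
    (F : Finset (Fin n → Fin q))
    (hw : ∀ x ∈ F, (Finset.univ.filter fun i => x i ≠ 0).card = k)
    (hdist : ∀ x ∈ F, ∀ y ∈ F, x ≠ y → hammingDist x y = d)
    (hcard : max (2 * k - d + 2) (max (d ^ 2 + d + 1) (q - 1)) < F.card) :
    Even d ∧ IsDeltaSystemQ n q k (k - d / 2) F ∧
      (F.card : ℝ) ≤ ((n : ℝ) - ((k - d / 2 : ℕ) : ℝ)) / ((d : ℝ) / 2) := by
  simp only [max_lt_iff] at hcard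
  obtain ⟨h1, h2, h3⟩ := hcard
  obtain ⟨D, hD, hagree, hout⟩ := Deza.exists_word_kernel hd0 hdk hw hdist h1 h2 h3
  obtain ⟨r, rfl⟩ : Even d := by
    rw [Nat.even_iff]; omega
  have hDcard : D.card = k - (r + r) / 2 := by omega
  have hdisj : ∀ x ∈ F, ∀ y ∈ F, x ≠ y →
      Disjoint ((Finset.univ.filter fun i => x i ≠ 0) \ D)
        ((Finset.univ.filter fun i => y i ≠ 0) \ D) := by
    intro x hx y hy hxy
    rw [Finset.disjoint_left]
    intro i hi hi'
    simp only [Finset.mem_sdiff, Finset.mem_filter, Finset.mem_univ, true_and] at hi hi'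
    exact hi.2 (hout x hx y hy hxy i hi.1 hi'.1)
  refine ⟨⟨r, rfl⟩, ⟨hw, D, hDcard, fun x hx y hy _ => hagree x hx y hy, hdisj⟩, ?_⟩
  have hpetal : ∀ x ∈ F, ((Finset.univ.filter fun i => x i ≠ 0) \ D).card = r := by
    intro x hx
    have hsub : D ⊆ Finset.univ.filter fun i => x i ≠ 0 := fun i hi => by
      simpa using (hagree x hx x hx i hi).2
    rw [Finset.card_sdiff_of_subset hsub, hw x hx]
    omega
  have hle : (F.biUnion fun x => (Finset.univ.filter fun i => x i ≠ 0) \ D).card ≤ Dᶜ.card := by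
    refine Finset.card_le_card (Finset.biUnion_subset.2 fun x _ i hi => ?_)
    exact Finset.mem_compl.2 (Finset.mem_sdiff.1 hi).2
  rw [Finset.card_biUnion hdisj, Finset.sum_congr rfl hpetal, Finset.sum_const, smul_eq_mul,
    Finset.card_compl, Fintype.card_fin] at hle
  have hDn : D.card ≤ n := by simpa using Finset.card_le_univ D
  have hfinal : F.card * r + D.card ≤ n := by omega
  have hr : (0 : ℝ) < r := by
    have : 0 < r := by omega
    exact_mod_cast this
  rw [← hDcard, le_div_iff₀ (by push_cast; linarith)]
  have : (F.card * r + D.card : ℝ) ≤ n := by exact_mod_cast hfinal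
  push_cast
  linarith
end

section
/- Let q ≥ 2 and let C ⊆ H_q^n be an equidistant code with common distance d > 0 that contains the all-zero word. If |C| > max{d² + d + 2, q}, then d is even and C \ {0} is a Δ_q(n, d, d/2)-system. -/
section Equidistant

variable {ι α : Type*} [Fintype ι] [Fintype α] [DecidableEq α]
  {C : Finset (ι → α)} {d : ℕ}

/-- For weights summing to zero, the squared column-class sums of an equidistant code add up
to `d` times the squared weights. -/
lemma sum_sq_class_of_equidistant
    (hC : ∀ x ∈ C, ∀ y ∈ C, x ≠ y → hammingDist x y = d) (c : (ι → α) → ℤ)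
    (hc : ∑ x ∈ C, c x = 0) :
    ∑ i, ∑ a, (∑ x ∈ C with x i = a, c x) ^ 2 = d * ∑ x ∈ C, c x ^ 2 := by
  have hcol : ∀ i, ∑ a, (∑ x ∈ C with x i = a, c x) ^ 2 =
      ∑ x ∈ C, ∑ y ∈ C, c x * c y * (if x i = y i then 1 else 0) := by
    intro i
    simp_rw [sq, Finset.sum_filter, Finset.sum_mul_sum]
    rw [Finset.sum_comm]
    refine Finset.sum_congr rfl fun x _ => ?_
    rw [Finset.sum_comm]
    refine Finset.sum_congr rfl fun y _ => ?_
    simp [eq_comm]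
  have hagree : ∀ x ∈ C, ∀ y ∈ C, ∑ i, (if x i = y i then (1 : ℤ) else 0) =
      (Fintype.card ι - d) + if x = y then (d : ℤ) else 0 := by
    intro x hx y hy
    split_ifs with h
    · subst h; simp
    · have hd : (hammingDist x y : ℤ) = d := by rw [hC x hx y hy h]
      have hsplit := Finset.card_filter_add_card_filter_not (s := Finset.univ) (fun i => x i = y i)
      rw [hammingDist] at hd
      rw [Finset.sum_boole, ← Finset.card_univ, ← hsplit, ← hd]
      push_cast
      ring
  simp_rw [hcol]
  rw [Finset.sum_comm]
  have hrow : ∀ x ∈ C, ∑ i, ∑ y ∈ C, c x * c y * (if x i = y i then 1 else 0) =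
      c x * (Fintype.card ι - d) * ∑ y ∈ C, c y + d * c x ^ 2 := by
    intro x hx
    rw [Finset.sum_comm]
    have : ∀ y ∈ C, ∑ i, c x * c y * (if x i = y i then 1 else 0) =
        c x * (Fintype.card ι - d) * c y + if x = y then d * (c x * c y) else 0 := by
      intro y hy
      rw [← Finset.mul_sum, hagree x hx y hy]
      split_ifs <;> ring
    rw [Finset.sum_congr rfl this, Finset.sum_add_distrib, ← Finset.mul_sum,
      Finset.sum_ite_eq, if_pos hx]
    ring
  rw [Finset.sum_congr rfl hrow, hc, Finset.mul_sum]
  simp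

lemma card_class_mul_card_compl_le
    (hC : ∀ x ∈ C, ∀ y ∈ C, x ≠ y → hammingDist x y = d) (i : ι) (a : α) :
    (C.filter fun x => x i = a).card * (C.filter fun x => x i ≠ a).card ≤ d * C.card := by
  have hsplit := Finset.card_filter_add_card_filter_not (s := C) (fun x => x i = a)
  set p := (C.filter fun x => x i = a).card with hp
  set r := (C.filter fun x => x i ≠ a).card with hr
  have hsum : ∀ u v : ℤ, ∑ x ∈ C, (if x i = a then u else v) = p * u + r * v := by
    intro u v
    rw [Finset.sum_ite]
    simp [hp, hr]
  have hsq := sum_sq_class_of_equidistant hC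
    (fun x => if x i = a then (r : ℤ) else -p) (by rw [hsum]; ring)
  have hclass : ∑ x ∈ C with x i = a, (if x i = a then (r : ℤ) else -p) = p * r := by
    rw [Finset.sum_congr rfl (g := fun _ => (r : ℤ))
      (fun x hx => if_pos (Finset.mem_filter.1 hx).2)]
    simp [hp]
  have hle : ((p : ℤ) * r) ^ 2 ≤ d * (p * r * C.card) := by
    calc ((p : ℤ) * r) ^ 2
        = (∑ x ∈ C with x i = a, (if x i = a then (r : ℤ) else -p)) ^ 2 := by rw [hclass]
      _ ≤ ∑ b, (∑ x ∈ C with x i = b, (if x i = a then (r : ℤ) else -p)) ^ 2 :=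
        Finset.single_le_sum
          (f := fun b => (∑ x ∈ C with x i = b, (if x i = a then (r : ℤ) else -p)) ^ 2)
          (fun _ _ => sq_nonneg _) (Finset.mem_univ a)
      _ ≤ ∑ j, ∑ b, (∑ x ∈ C with x j = b, (if x i = a then (r : ℤ) else -p)) ^ 2 :=
        Finset.single_le_sum
          (f := fun j => ∑ b, (∑ x ∈ C with x j = b, (if x i = a then (r : ℤ) else -p)) ^ 2)
          (fun _ _ => Finset.sum_nonneg fun _ _ => sq_nonneg _) (Finset.mem_univ i)
      _ = d * (p * r * C.card) := by
        rw [hsq]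
        simp_rw [ite_pow]
        rw [hsum, ← hsplit]
        push_cast
        ring
  rcases Nat.eq_zero_or_pos (p * r) with h0 | hpos
  · omega
  · have hle' : p * r * (p * r) ≤ p * r * (d * C.card) := by
      zify
      linarith
    exact Nat.le_of_mul_le_mul_left hle' hpos

lemma card_class_le_or_card_compl_le
    (hC : ∀ x ∈ C, ∀ y ∈ C, x ≠ y → hammingDist x y = d)
    (hcard : d ^ 2 + d + 2 < C.card) (i : ι) (a : α) :
    (C.filter fun x => x i = a).card ≤ d + 1 ∨ (C.filter fun x => x i ≠ a).card ≤ d + 1 := by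
  have hmul := card_class_mul_card_compl_le hC i a
  have hsplit := Finset.card_filter_add_card_filter_not (s := C) (fun x => x i = a)
  by_contra! h
  obtain ⟨u, hu⟩ := Nat.exists_eq_add_of_lt h.1
  obtain ⟨v, hv⟩ := Nat.exists_eq_add_of_lt h.2
  rw [← hsplit] at hmul hcard
  rw [hu, hv] at hmul hcard
  nlinarith [sq_nonneg ((d : ℤ) - 1), Nat.zero_le (u * v)]

/-- Every column of a large equidistant code either has only small classes (columns in `S`),
or a symbol `z i` taken by almost all codewords. -/
lemma exists_spread_columns_and_majority
    (hC : ∀ x ∈ C, ∀ y ∈ C, x ≠ y → hammingDist x y = d)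
    (hcard : d ^ 2 + d + 2 < C.card) :
    ∃ (S : Finset ι) (z : ι → α),
      (∀ i ∈ S, ∀ a, (C.filter fun x => x i = a).card ≤ d + 1) ∧
        ∀ i ∉ S, (C.filter fun x => x i ≠ z i).card ≤ d + 1 := by
  obtain ⟨x₀, -⟩ : C.Nonempty := Finset.card_pos.1 (by omega)
  have hex : ∀ i, ∃ b, (∀ a, (C.filter fun x => x i = a).card ≤ d + 1) ∨
      (C.filter fun x => x i ≠ b).card ≤ d + 1 := by
    intro i
    by_cases h : ∀ a, (C.filter fun x => x i = a).card ≤ d + 1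
    · exact ⟨x₀ i, Or.inl h⟩
    · push Not at h
      obtain ⟨b, hb⟩ := h
      exact ⟨b, Or.inr ((card_class_le_or_card_compl_le hC hcard i b).resolve_left
        (not_le.2 hb))⟩
  choose z hz using hex
  refine ⟨Finset.univ.filter fun i => ∀ a, (C.filter fun x => x i = a).card ≤ d + 1, z, ?_, ?_⟩
  · intro i hi
    exact (Finset.mem_filter.1 hi).2
  · intro i hi
    exact (hz i).resolve_left fun h => hi (Finset.mem_filter.2 ⟨Finset.mem_univ i, h⟩)

/-- The codewords of a large equidistant code all lie at distance `d / 2` from a common centre,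
and they differ from it in pairwise disjoint sets of columns. -/
lemma exists_center_of_equidistant [DecidableEq ι]
    (hC : ∀ x ∈ C, ∀ y ∈ C, x ≠ y → hammingDist x y = d)
    (hcard : d ^ 2 + d + 2 < C.card) (hα : Fintype.card α < C.card) :
    ∃ z : ι → α, (∀ x ∈ C, 2 * hammingDist x z = d) ∧
      ∀ x ∈ C, ∀ y ∈ C, x ≠ y → ∀ i, x i = z i ∨ y i = z i := by
  obtain ⟨S, z, hS, hz⟩ := exists_spread_columns_and_majority hC hcard
  let W : (ι → α) → Finset ι := fun x => Finset.univ.filter fun i => i ∉ S ∧ x i ≠ z i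
  have hW : ∀ x i, i ∈ W x ↔ i ∉ S ∧ x i ≠ z i := fun x i => by simp [W]
  have hSW : ∀ x, Disjoint S (W x) := fun x =>
    Finset.disjoint_left.2 fun i hi hi' => ((hW x i).1 hi').1 hi
  have hle : ∀ x y, hammingDist x y ≤ S.card + (W x ∪ W y).card := by
    intro x y
    refine (Finset.card_le_card (t := S ∪ (W x ∪ W y)) fun i hi => ?_).trans
      (Finset.card_union_le _ _)
    have hne : x i ≠ y i := (Finset.mem_filter.1 hi).2
    simp only [Finset.mem_union, hW]
    grind
  have hconf : ∀ x ∈ C, ∀ i ∈ S ∪ W x,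
      ((C.erase x).filter fun y => y i = x i ∨ i ∈ W y).card ≤ d := by
    intro x hx i hi
    have key : ∀ P : (ι → α) → Prop, ∀ [DecidablePred P], P x → (C.filter P).card ≤ d + 1 →
        (∀ y, (y i = x i ∨ i ∈ W y) → P y) →
        ((C.erase x).filter fun y => y i = x i ∨ i ∈ W y).card ≤ d := by
      intro P _ hPx hP himp
      have hsub : ((C.erase x).filter fun y => y i = x i ∨ i ∈ W y) ⊆ (C.filter P).erase x := by
        intro y hy
        simp only [Finset.mem_filter, Finset.mem_erase] at hy ⊢
        exact ⟨hy.1.1, hy.1.2, himp y hy.2⟩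
      have h1 := Finset.card_le_card hsub
      rw [Finset.card_erase_of_mem (Finset.mem_filter.2 ⟨hx, hPx⟩)] at h1
      omega
    by_cases hiS : i ∈ S
    · refine key (fun y => y i = x i) rfl (hS i hiS _) fun y hy => ?_
      exact hy.resolve_right fun h => ((hW y i).1 h).1 hiS
    · have hxi := ((hW x i).1 ((Finset.mem_union.1 hi).resolve_left hiS)).2
      refine key (fun y => y i ≠ z i) hxi (hz i hiS) fun y hy => ?_
      rcases hy with hy | hy
      · rwa [hy]
      · exact ((hW y i).1 hy).2
  have hT : ∀ x ∈ C, (S ∪ W x).card ≤ d := by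
    intro x hx
    have hlow : ∀ i ∈ S ∪ W x,
        C.card - 1 - d ≤ ((C.erase x).filter fun y => x i ≠ y i).card := by
      intro i hi
      have h1 := Finset.card_filter_add_card_filter_not (s := C.erase x) (fun y => x i = y i)
      have h2 : ((C.erase x).filter fun y => x i = y i).card ≤ d :=
        (Finset.card_le_card (Finset.monotone_filter_right _
          fun y _ hy => Or.inl hy.symm)).trans (hconf x hx i hi)
      rw [Finset.card_erase_of_mem hx] at h1
      simp only [ne_eq]
      omega
    have hcount : (S ∪ W x).card * (C.card - 1 - d) ≤ (C.card - 1) * d := by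
      calc (S ∪ W x).card * (C.card - 1 - d)
          ≤ ∑ i ∈ S ∪ W x, ((C.erase x).filter fun y => x i ≠ y i).card := by
            rw [← smul_eq_mul]; exact Finset.card_nsmul_le_sum _ _ _ hlow
        _ ≤ ∑ i, ((C.erase x).filter fun y => x i ≠ y i).card :=
            Finset.sum_le_sum_of_subset (Finset.subset_univ _)
        _ = ∑ y ∈ C.erase x, hammingDist x y := by
            simp_rw [hammingDist, Finset.card_filter]
            exact Finset.sum_comm
        _ = (C.card - 1) * d := by
            rw [Finset.sum_congr rfl fun y hy => hC x hx y (Finset.mem_of_mem_erase hy)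
              (Finset.ne_of_mem_erase hy).symm, Finset.sum_const,
              Finset.card_erase_of_mem hx, smul_eq_mul]
    obtain ⟨m, hm⟩ : ∃ m, C.card = m + d + 1 := ⟨C.card - d - 1, by omega⟩
    have e1 : C.card - 1 - d = m := by omega
    have e2 : C.card - 1 = m + d := by omega
    rw [e1, e2] at hcount
    by_contra! hlt
    have := Nat.mul_le_mul_right m (Nat.succ_le_of_lt hlt)
    simp only [Nat.succ_eq_add_one] at this
    nlinarith
  have hcardT : ∀ x, (S ∪ W x).card = S.card + (W x).card := fun x =>
    Finset.card_union_of_disjoint (hSW x)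
  -- Most codewords disagree with `x` on `S` and deviate from `z` in other columns than `x`.
  have hnbr : ∀ x ∈ C, ∃ y ∈ C, ∃ y' ∈ C, y ≠ y' ∧
      d = S.card + (W x).card + (W y).card ∧ d = S.card + (W x).card + (W y').card := by
    intro x hx
    let B := (S ∪ W x).biUnion fun i => (C.erase x).filter fun y => y i = x i ∨ i ∈ W y
    have hB : B.card ≤ d * d :=
      (Finset.card_biUnion_le_card_mul _ _ d (hconf x hx)).trans
        (Nat.mul_le_mul_right d (hT x hx))
    have hone : 1 < (C.erase x \ B).card := by
      have := Finset.le_card_sdiff B (C.erase x)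
      rw [Finset.card_erase_of_mem hx] at this
      have : d ^ 2 = d * d := sq d
      omega
    have hd : ∀ y ∈ C.erase x \ B, d = S.card + (W x).card + (W y).card := by
      intro y hy
      rw [Finset.mem_sdiff, Finset.mem_erase] at hy
      obtain ⟨⟨hyx, hyC⟩, hyB⟩ := hy
      have hgood : ∀ i ∈ S ∪ W x, y i ≠ x i ∧ i ∉ W y := by
        intro i hi
        by_contra hcon
        refine hyB (Finset.mem_biUnion.2 ⟨i, hi, Finset.mem_filter.2
          ⟨Finset.mem_erase.2 ⟨hyx, hyC⟩, ?_⟩⟩)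
        tauto
      have hdisj : Disjoint (S ∪ W x) (W y) :=
        Finset.disjoint_left.2 fun i hi => (hgood i hi).2
      have hsub : S ∪ W x ∪ W y ⊆ Finset.univ.filter fun i => x i ≠ y i := by
        intro i hi
        refine Finset.mem_filter.2 ⟨Finset.mem_univ i, ?_⟩
        by_cases hix : i ∈ S ∪ W x
        · exact (hgood i hix).1.symm
        · have hiy := (hW y i).1 ((Finset.mem_union.1 hi).resolve_left hix)
          have : x i = z i := by
            by_contra hne
            exact hix (Finset.mem_union_right _ ((hW x i).2 ⟨hiy.1, hne⟩))
          rw [this]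
          exact hiy.2.symm
      have h1 := Finset.card_le_card hsub
      rw [Finset.card_union_of_disjoint hdisj, hcardT] at h1
      have h2 := hle x y
      have h3 := Finset.card_union_le (W x) (W y)
      have h4 := hC x hx y hyC hyx.symm
      have h5 : hammingDist x y = (Finset.univ.filter fun i => x i ≠ y i).card := rfl
      omega
    obtain ⟨y, hy, y', hy', hne⟩ := Finset.one_lt_card.1 hone
    exact ⟨y, Finset.mem_of_mem_erase (Finset.mem_sdiff.1 hy).1, y',
      Finset.mem_of_mem_erase (Finset.mem_sdiff.1 hy').1, hne, hd y hy, hd y' hy'⟩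
  have hupper : ∀ x ∈ C, S.card + 2 * (W x).card ≤ d := by
    intro x hx
    obtain ⟨y, hy, y', hy', hne, h1, h2⟩ := hnbr x hx
    have h3 := hle y y'
    have h4 := Finset.card_union_le (W y) (W y')
    have h5 := hC y hy y' hy' hne
    omega
  have hW2 : ∀ x ∈ C, S.card + 2 * (W x).card = d := by
    intro x hx
    obtain ⟨y, hy, -, -, -, h1, -⟩ := hnbr x hx
    have h2 := hupper x hx
    have h3 := hupper y hy
    omega
  have hWdisj : ∀ x ∈ C, ∀ y ∈ C, x ≠ y → Disjoint (W x) (W y) := by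
    intro x hx y hy hne
    have h1 := hle x y
    rw [hC x hx y hy hne] at h1
    have h2 := hW2 x hx
    have h3 := hW2 y hy
    have h4 := Finset.card_union_add_card_inter (W x) (W y)
    rw [Finset.disjoint_iff_inter_eq_empty, ← Finset.card_eq_zero]
    omega
  have hSne : ∀ i ∈ S, ∀ x ∈ C, ∀ y ∈ C, x ≠ y → x i ≠ y i := by
    intro i hi x hx y hy hne heq
    have hsub : (Finset.univ.filter fun i => x i ≠ y i) ⊆ S.erase i ∪ (W x ∪ W y) := by
      intro j hj
      have hj' : x j ≠ y j := (Finset.mem_filter.1 hj).2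
      have hji : j ≠ i := by rintro rfl; exact hj' heq
      simp only [Finset.mem_union, hW, Finset.mem_erase]
      grind
    have h1 := (Finset.card_le_card hsub).trans (Finset.card_union_le _ _)
    have h2 := Finset.card_union_le (W x) (W y)
    have h3 : (Finset.univ.filter fun i => x i ≠ y i).card = d := hC x hx y hy hne
    have h4 := Finset.card_erase_lt_of_mem hi
    have h5 := hW2 x hx
    have h6 := hW2 y hy
    omega
  have hSempty : S = ∅ := by
    by_contra hSnon
    obtain ⟨i, hi⟩ := Finset.nonempty_iff_ne_empty.2 hSnon
    refine absurd (Finset.card_le_card_of_injOn (s := C) (t := Finset.univ) (fun x : ι → α => x i)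
      (fun _ _ => Finset.mem_coe.2 (Finset.mem_univ _)) fun x hx y hy h => ?_)
      (by rw [Finset.card_univ]; exact not_le.2 hα)
    by_contra hne
    exact hSne i hi x hx y hy hne h
  subst hSempty
  refine ⟨z, fun x hx => ?_, fun x hx y hy hne i => ?_⟩
  · have h1 := hW2 x hx
    have h2 : hammingDist x z = (W x).card := by simp [W, hammingDist]
    simp only [Finset.card_empty] at h1
    omega
  · by_contra! h
    exact Finset.disjoint_left.1 (hWdisj x hx y hy hne) ((hW x i).2 ⟨by simp, h.1⟩)
      ((hW y i).2 ⟨by simp, h.2⟩)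

end Equidistant

/-- If a `q`-ary equidistant code with distance `d > 0` contains the all-zero word and
has more than `max {d² + d + 2, q}` codewords, then `d` is even and its nonzero
codewords form a `Δ_q(n, d, d/2)`-system. -/
theorem qary_equidistant_deltaSystem (q n d : ℕ) [NeZero q] (hq : 2 ≤ q) (hd0 : 0 < d)
    (C : Finset (Fin n → Fin q)) (h0 : (0 : Fin n → Fin q) ∈ C)
    (hC : ∀ x ∈ C, ∀ y ∈ C, x ≠ y → hammingDist x y = d)
    (hcard : max (d ^ 2 + d + 2) q < C.card) :
    Even d ∧ IsDeltaSystemQ n q d (d / 2) (C.erase 0) := by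
  obtain ⟨z, hz, hdisj⟩ := exists_center_of_equidistant hC (lt_of_le_of_lt (le_max_left _ _) hcard)
    (by simpa using lt_of_le_of_lt (le_max_right _ _) hcard)
  have hz0 := hz 0 h0
  have hzero : ∀ x ∈ C.erase 0, ∀ i, x i = z i ∨ z i = 0 := by
    intro x hx i
    have := hdisj x (Finset.mem_of_mem_erase hx) 0 h0 (Finset.ne_of_mem_erase hx) i
    exact this.imp_right Eq.symm
  refine ⟨⟨hammingDist 0 z, by omega⟩, fun x hx => ?_,
    Finset.univ.filter fun i => z i ≠ 0, ?_, ?_, ?_⟩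
  · have := hC x (Finset.mem_of_mem_erase hx) 0 h0 (Finset.ne_of_mem_erase hx)
    simpa [hammingDist] using this
  · have : hammingDist 0 z = (Finset.univ.filter fun i => z i ≠ 0).card := by
      simp [hammingDist, eq_comm]
    omega
  · intro x hx y hy _ i hi
    have hi' := (Finset.mem_filter.1 hi).2
    have h1 := (hzero x hx i).resolve_right hi'
    have h2 := (hzero y hy i).resolve_right hi'
    exact ⟨h1.trans h2.symm, h1 ▸ hi'⟩
  · intro x hx y hy hne
    refine Finset.disjoint_left.2 fun i hi hi' => ?_
    simp only [Finset.mem_sdiff, Finset.mem_filter, Finset.mem_univ, true_and, not_not]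
      at hi hi'
    rcases hdisj x (Finset.mem_of_mem_erase hx) y (Finset.mem_of_mem_erase hy) hne i with h | h
    · exact hi.1 (h.trans hi.2)
    · exact hi'.1 (h.trans hi.2)
end

section
/- Let q ≥ 2 and let C ⊆ H_q^n be an equidistant code with common distance d > 0. Then |C| ≤ max{d² + d + 2, q, ⌊2n/d⌋}. In particular, if n ≥ max{d(d² + d + 2)/2, dq/2}, then |C| ≤ ⌊2n/d⌋. -/
open Finset

section SetFamily

variable {ι J : Type*} [DecidableEq J]

lemma card_symmDiff_add_two_mul_card_inter (A B : Finset J) :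
    (symmDiff A B).card + 2 * (A ∩ B).card = A.card + B.card := by
  have h1 : (symmDiff A B).card = (A \ B).card + (B \ A).card := by
    rw [symmDiff_def, sup_eq_union, card_union_of_disjoint]
    exact disjoint_sdiff_sdiff
  have h2 := card_sdiff_add_card_inter A B
  have h3 := card_sdiff_add_card_inter B A
  rw [inter_comm B A] at h3
  omega

/-- Double counting of the pairs `(y, j)` with `j ∈ A ∩ S y`. -/
lemma sum_card_inter_eq_sum_degree (s : Finset ι) (S : ι → Finset J) (A : Finset J) :
    ∑ y ∈ s, (A ∩ S y).card = ∑ j ∈ A, (s.filter (fun y => j ∈ S y)).card := by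
  simp only [← filter_mem_eq_inter, card_filter]
  exact sum_comm

/-- If a large family of sets has all pairwise symmetric differences of size `2 * k` and every
point lies in at most `k` of the sets, then the sets are pairwise disjoint. -/
theorem card_filter_mem_le_one_of_card_symmDiff_eq [DecidableEq ι] (k : ℕ) (s : Finset ι) (S : ι → Finset J)
    (hS : ∀ x ∈ s, ∀ y ∈ s, x ≠ y → (symmDiff (S x) (S y)).card = 2 * k)
    (hdeg : ∀ j, (s.filter (fun y => j ∈ S y)).card ≤ k)
    (hs : k ^ 2 + k + 3 ≤ s.card) (j : J) :
    (s.filter (fun y => j ∈ S y)).card ≤ 1 := by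
  have hI : ∀ x ∈ s, ∀ y ∈ s, x ≠ y →
      (2 : ℤ) * (S x ∩ S y).card = (S x).card + (S y).card - 2 * k := by
    intro x hx y hy hxy
    have h1 := card_symmDiff_add_two_mul_card_inter (S x) (S y)
    have h2 := hS x hx y hy hxy
    omega
  set M : ℤ := (s.card : ℤ) with hM
  have hMk : (k : ℤ) ^ 2 + k + 3 ≤ M := by rw [hM]; exact_mod_cast hs
  set W : ℤ := ∑ x ∈ s, ((S x).card : ℤ) with hW
  have hrow : ∀ x ∈ s, 2 * ∑ y ∈ s, ((S x ∩ S y).card : ℤ)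
      = M * (S x).card + W - 2 * k * (M - 1) := by
    intro x hx
    have h1 : ∑ y ∈ s.erase x, ((2 : ℤ) * (S x ∩ S y).card)
        = ∑ y ∈ s.erase x, (((S x).card : ℤ) + (S y).card - 2 * k) :=
      sum_congr rfl fun y hy =>
        hI x hx y (mem_of_mem_erase hy) (ne_of_mem_erase hy).symm
    have h2 := add_sum_erase s (fun y => (2 : ℤ) * (S x ∩ S y).card) hx
    have h3 := add_sum_erase s (fun y => ((S x).card : ℤ) + (S y).card - 2 * k) hx
    simp only [inter_self] at h2
    have h4 : ∑ y ∈ s, (((S x).card : ℤ) + (S y).card - 2 * k)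
        = M * (S x).card + W - M * (2 * k) := by
      rw [sum_sub_distrib, sum_add_distrib, sum_const, sum_const, nsmul_eq_mul, nsmul_eq_mul]
    rw [mul_sum, ← h2, h1]
    linarith
  have hself : ∀ x ∈ s, ∀ j ∈ S x, 1 ≤ (s.filter (fun y => j ∈ S y)).card := by
    intro x hx j hj
    exact card_pos.2 ⟨x, mem_filter.2 ⟨hx, hj⟩⟩
  have hdc : ∀ x ∈ s, ∑ y ∈ s, ((S x ∩ S y).card : ℤ) ≤ k * (S x).card := by
    intro x _
    have h1 := sum_card_inter_eq_sum_degree s S (S x)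
    have h2 := sum_le_card_nsmul (S x) (fun j => (s.filter (fun y => j ∈ S y)).card) k
      (fun j _ => hdeg j)
    rw [← h1, smul_eq_mul, mul_comm] at h2
    exact_mod_cast h2
  have hdc' : ∀ x ∈ s, ((S x).card : ℤ) ≤ ∑ y ∈ s, ((S x ∩ S y).card : ℤ) := by
    intro x hx
    have h1 := sum_card_inter_eq_sum_degree s S (S x)
    have h2 := card_nsmul_le_sum (S x) (fun j => (s.filter (fun y => j ∈ S y)).card) 1
      (hself x hx)
    rw [← h1, smul_eq_mul, mul_one] at h2
    exact_mod_cast h2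
  have hWk : k * M ≤ W := by
    have h1 : ∑ x ∈ s, 2 * ((S x).card : ℤ)
        ≤ ∑ x ∈ s, (M * (S x).card + W - 2 * k * (M - 1)) :=
      sum_le_sum fun x hx => by
        have := hrow x hx
        have := hdc' x hx
        linarith
    rw [sum_sub_distrib, sum_add_distrib, sum_const, sum_const, nsmul_eq_mul, nsmul_eq_mul,
      ← mul_sum, ← mul_sum, ← hW, ← hM] at h1
    have h2 : (0 : ℤ) < M - 1 := by nlinarith
    nlinarith
  have hw : ∀ x ∈ s, ((S x).card : ℤ) ≤ k + 1 := by
    intro x hx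
    by_contra! hcon
    have h1 := hrow x hx
    have h2 := hdc x hx
    have h3 : (0 : ℤ) ≤ M - 2 * k := by nlinarith [sq_nonneg ((k : ℤ) - 1)]
    nlinarith
  by_cases hex : ∃ x ∈ s, ((S x).card : ℤ) = k + 1
  · exfalso
    obtain ⟨x, hx, hxk⟩ := hex
    have hzero : ((s.erase x).filter (fun y => (S x ∩ S y).card = 0)).card ≤ 1 := by
      rw [card_le_one]
      intro y hy z hz
      by_contra hyz
      simp only [mem_filter, mem_erase] at hy hz
      have h1 := hI x hx y hy.1.2 (Ne.symm hy.1.1)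
      have h2 := hI x hx z hz.1.2 (Ne.symm hz.1.1)
      have h3 := hI y hy.1.2 z hz.1.2 hyz
      omega
    have hpos : (s.erase x).card ≤ ∑ y ∈ s.erase x, (S x ∩ S y).card
        + ((s.erase x).filter (fun y => (S x ∩ S y).card = 0)).card := by
      rw [card_filter, ← sum_add_distrib, card_eq_sum_ones]
      refine sum_le_sum fun y _ => ?_
      split_ifs <;> omega
    have h1 := hdc x hx
    have h2 := add_sum_erase s (fun y => ((S x ∩ S y).card : ℤ)) hx
    have h3 := card_erase_add_one hx
    simp only [inter_self] at h2
    rw [← h2, hxk] at h1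
    zify at hpos hzero h3
    nlinarith
  · push Not at hex
    rw [card_le_one]
    intro y hy z hz
    by_contra hyz
    simp only [mem_filter] at hy hz
    have h1 := hI y hy.1 z hz.1 hyz
    have h2 := hw y hy.1
    have h3 := hw z hz.1
    have h4 := hex y hy.1
    have h5 := hex z hz.1
    have h6 : 0 < (S y ∩ S z).card := card_pos.2 ⟨j, mem_inter.2 ⟨hy.2, hz.2⟩⟩
    omega

end SetFamily

section Code

variable {n q d : ℕ} {C : Finset (Fin n → Fin q)}

lemma sum_ite_eq_eq_sub_hammingDist (x y : Fin n → Fin q) :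
    ∑ i, (if x i = y i then (1 : ℤ) else 0) = n - hammingDist x y := by
  have h : ∀ i, (if x i = y i then (1 : ℤ) else 0) = 1 - if x i ≠ y i then 1 else 0 := by
    intro i
    by_cases hi : x i = y i <;> simp [hi]
  simp only [h, sum_sub_distrib]
  simp [hammingDist, card_filter]

/-- The quadratic form of the simplex spanned by an equidistant code. -/
lemma sum_sq_sum_ite_eq (hC : ∀ x ∈ C, ∀ y ∈ C, x ≠ y → hammingDist x y = d)
    (u : (Fin n → Fin q) → ℤ) (hu : ∑ x ∈ C, u x = 0) :
    ∑ i, ∑ a, (∑ x ∈ C, if x i = a then u x else 0) ^ 2 = d * ∑ x ∈ C, u x ^ 2 := by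
  have h1 : ∀ i : Fin n, ∑ a, (∑ x ∈ C, if x i = a then u x else 0) ^ 2
      = ∑ x ∈ C, ∑ y ∈ C, u x * u y * (if x i = y i then 1 else 0) := by
    intro i
    simp only [sq, sum_mul_sum]
    rw [sum_comm]
    refine sum_congr rfl fun x _ => ?_
    rw [sum_comm]
    refine sum_congr rfl fun y _ => ?_
    simp only [ite_mul, zero_mul, sum_ite_eq, mem_univ, if_true]
    by_cases h : x i = y i
    · simp [h]
    · simp [h, Ne.symm h]
  simp only [h1]
  rw [sum_comm]
  have h2 : ∀ x ∈ C, ∑ i, ∑ y ∈ C, u x * u y * (if x i = y i then (1 : ℤ) else 0)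
      = d * u x ^ 2 := by
    intro x hx
    rw [sum_comm]
    have h3 : ∀ y ∈ C, ∑ i, u x * u y * (if x i = y i then (1 : ℤ) else 0)
        = u x * (n - d) * u y + if x = y then d * u x ^ 2 else 0 := by
      intro y hy
      rw [← mul_sum, sum_ite_eq_eq_sub_hammingDist]
      by_cases h : x = y
      · subst h
        simp
        ring
      · rw [hC x hx y hy h]
        simp [h]
        ring
    rw [sum_congr rfl h3, sum_add_distrib, ← mul_sum, hu]
    simp [hx]
  rw [sum_congr rfl h2, ← mul_sum]

lemma card_filter_mul_le (hC : ∀ x ∈ C, ∀ y ∈ C, x ≠ y → hammingDist x y = d)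
    (i : Fin n) (a : Fin q) (hf : 0 < (C.filter (fun x => x i = a)).card)
    (hg : 0 < (C.filter (fun x => x i ≠ a)).card) :
    (C.filter (fun x => x i = a)).card * ((C.filter (fun x => x i ≠ a)).card + 1)
      ≤ d * ((C.filter (fun x => x i = a)).card + (C.filter (fun x => x i ≠ a)).card) := by
  set f := (C.filter (fun x => x i = a)).card with hfdef
  set g := (C.filter (fun x => x i ≠ a)).card with hgdef
  let u : (Fin n → Fin q) → ℤ := fun x => if x i = a then g else -f
  have hu : ∑ x ∈ C, u x = 0 := by
    simp only [u, sum_ite, sum_const, nsmul_eq_mul, ← hfdef, ← ne_eq, ← hgdef]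
    ring
  have hu2 : ∑ x ∈ C, u x ^ 2 = f * g * (f + g) := by
    simp only [u, ite_pow, sum_ite, sum_const, nsmul_eq_mul, ← hfdef, ← ne_eq, ← hgdef]
    ring
  have hq := sum_sq_sum_ite_eq hC u hu
  rw [hu2] at hq
  have hi : ∑ b, (∑ x ∈ C, if x i = b then u x else 0) ^ 2
      ≤ ∑ i, ∑ b, (∑ x ∈ C, if x i = b then u x else 0) ^ 2 :=
    single_le_sum (f := fun i => ∑ b, (∑ x ∈ C, if x i = b then u x else 0) ^ 2)
      (fun _ _ => sum_nonneg fun _ _ => sq_nonneg _) (mem_univ i)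
  have ha : ∑ x ∈ C, (if x i = a then u x else 0) = f * g := by
    rw [← sum_filter, sum_congr rfl (g := fun _ => (g : ℤ)), sum_const, nsmul_eq_mul]
    intro x hx
    simp [u, (mem_filter.1 hx).2]
  have hb : ∀ b ∈ univ.erase a, (f : ℤ) ^ 2 * (C.filter (fun x => x i = b)).card
      ≤ (∑ x ∈ C, if x i = b then u x else 0) ^ 2 := by
    intro b hb
    have hba := ne_of_mem_erase hb
    have : ∑ x ∈ C, (if x i = b then u x else 0)
        = (C.filter (fun x => x i = b)).card * (-f : ℤ) := by
      rw [← sum_filter, sum_congr rfl (g := fun _ => (-f : ℤ)), sum_const, nsmul_eq_mul]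
      intro x hx
      simp [u, (mem_filter.1 hx).2, hba]
    rw [this, mul_pow, neg_sq, mul_comm]
    have h1 : ((C.filter (fun x => x i = b)).card : ℤ)
        ≤ ((C.filter (fun x => x i = b)).card : ℤ) ^ 2 := by
      exact_mod_cast Nat.le_self_pow two_ne_zero _
    exact mul_le_mul_of_nonneg_right h1 (sq_nonneg _)
  have hgsum : (g : ℤ) = ∑ b ∈ univ.erase a, ((C.filter (fun x => x i = b)).card : ℤ) := by
    have h1 := card_eq_sum_card_fiberwise (s := C) (t := univ) (f := fun x => x i)
      (fun _ _ => mem_coe.2 (mem_univ _))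
    have h2 := add_sum_erase univ (fun b => (C.filter (fun x => x i = b)).card) (mem_univ a)
    have h3 := card_filter_add_card_filter_not (s := C) (fun x => x i = a)
    simp only [← ne_eq] at h3
    rw [← hfdef, ← hgdef] at h3
    simp only [← hfdef] at h2
    have h4 : g = ∑ b ∈ univ.erase a, (C.filter (fun x => x i = b)).card := by omega
    exact_mod_cast h4
  have hsum := sum_le_sum hb
  rw [← mul_sum, ← hgsum] at hsum
  have hsplit := add_sum_erase univ
    (fun b => (∑ x ∈ C, if x i = b then u x else 0) ^ 2) (mem_univ a)
  simp only [ha] at hsplit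
  have hfin : ((f : ℤ) * g) * (f * (g + 1)) ≤ (f * g) * (d * (f + g)) := by nlinarith
  have hfg : (0 : ℤ) < f * g := by positivity
  exact_mod_cast le_of_mul_le_mul_left hfin hfg

lemma card_filter_le_or_le (hd0 : 0 < d)
    (hC : ∀ x ∈ C, ∀ y ∈ C, x ≠ y → hammingDist x y = d)
    (hcard : d ^ 2 + d + 3 ≤ C.card) (i : Fin n) (a : Fin q) :
    (C.filter (fun x => x i = a)).card ≤ d ∨ (C.filter (fun x => x i ≠ a)).card ≤ d := by
  by_contra! h
  obtain ⟨hf, hg⟩ := h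
  have h1 := card_filter_mul_le hC i a (by omega) (by omega)
  have h2 := card_filter_add_card_filter_not (s := C) (fun x => x i = a)
  simp only [← ne_eq] at h2
  obtain ⟨s, hs⟩ := Nat.exists_eq_add_of_lt hf
  obtain ⟨t, ht⟩ := Nat.exists_eq_add_of_lt hg
  rw [hs, ht] at h1 h2
  nlinarith [Nat.zero_le (s * t)]

/-- In a large equidistant code, every symbol occurs at most once, or all but at most once,
at each coordinate. -/
lemma card_filter_le_one_or_le_one (hd0 : 0 < d)
    (hC : ∀ x ∈ C, ∀ y ∈ C, x ≠ y → hammingDist x y = d)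
    (hcard : d ^ 2 + d + 3 ≤ C.card) (i : Fin n) (a : Fin q) :
    (C.filter (fun x => x i = a)).card ≤ 1 ∨ (C.filter (fun x => x i ≠ a)).card ≤ 1 := by
  let Z : Finset (Fin n × Fin q) :=
    univ.filter fun p => d < (C.filter (fun x => x p.1 = p.2)).card
  let G : (Fin n → Fin q) → Finset (Fin n × Fin q) := fun x => univ.filter fun p => x p.1 = p.2
  have hG : ∀ x p, p ∈ G x ↔ x p.1 = p.2 := fun x p => by simp [G]
  have hGcard : ∀ x, (G x).card = n := by
    intro x
    have : G x = univ.image fun i => (i, x i) := by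
      ext ⟨i, b⟩
      simp [G]
    rw [this, card_image_of_injective _ fun i j h => (Prod.mk.inj h).1]
    simp
  have hGinter : ∀ x y, (G x ∩ G y).card + hammingDist x y = n := by
    intro x y
    have : G x ∩ G y = (univ.filter fun i => x i = y i).image fun i => (i, x i) := by
      ext ⟨i, b⟩
      simp only [mem_inter, hG, mem_image, mem_filter, mem_univ, true_and, Prod.mk.injEq]
      constructor
      · rintro ⟨h1, h2⟩
        exact ⟨i, h1.trans h2.symm, rfl, h1⟩
      · rintro ⟨j, h1, rfl, h2⟩
        exact ⟨h2, h1 ▸ h2⟩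
    rw [this, card_image_of_injective _ fun i j h => (Prod.mk.inj h).1]
    have := card_filter_add_card_filter_not (s := univ) (fun i => x i = y i)
    simpa [hammingDist] using this
  have hsymm : ∀ x ∈ C, ∀ y ∈ C, x ≠ y →
      (symmDiff (symmDiff (G x) Z) (symmDiff (G y) Z)).card = 2 * d := by
    intro x hx y hy hxy
    rw [symmDiff_symmDiff_symmDiff_comm, symmDiff_self, symmDiff_bot]
    have h1 := card_symmDiff_add_two_mul_card_inter (G x) (G y)
    have h2 := hGinter x y
    rw [hC x hx y hy hxy] at h2
    rw [hGcard, hGcard] at h1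
    omega
  have hmem : ∀ p : Fin n × Fin q, C.filter (fun x => p ∈ symmDiff (G x) Z)
      = if p ∈ Z then C.filter (fun x => x p.1 ≠ p.2) else C.filter (fun x => x p.1 = p.2) := by
    intro p
    by_cases hp : p ∈ Z <;> simp [mem_symmDiff, hG, hp]
  have hdeg : ∀ p : Fin n × Fin q, (C.filter (fun x => p ∈ symmDiff (G x) Z)).card ≤ d := by
    intro p
    rw [hmem]
    have := card_filter_le_or_le hd0 hC hcard p.1 p.2
    split_ifs with hp
    · have hp' : d < (C.filter (fun x => x p.1 = p.2)).card := (mem_filter.1 hp).2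
      omega
    · simpa [Z] using hp
  have := card_filter_mem_le_one_of_card_symmDiff_eq d C (fun x => symmDiff (G x) Z) hsymm hdeg
    hcard (i, a)
  simp only [hmem] at this
  split_ifs at this
  · exact Or.inr this
  · exact Or.inl this

lemma card_mul_le_two_mul (hd0 : 0 < d)
    (hC : ∀ x ∈ C, ∀ y ∈ C, x ≠ y → hammingDist x y = d)
    (hcard : d ^ 2 + d + 3 ≤ C.card) (hqC : q < C.card) : C.card * d ≤ 2 * n := by
  have hcol : ∀ i : Fin n, ∑ x ∈ C, (C.filter (fun y => x i ≠ y i)).card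
      ≤ 2 * (C.card - 1) := by
    intro i
    obtain ⟨x, hx, y, hy, hxy, hxyi⟩ := exists_ne_map_eq_of_card_lt_of_maps_to
      (s := C) (t := univ) (f := fun x => x i) (by simpa using hqC)
      (fun _ _ => mem_coe.2 (mem_univ _))
    have hone : (C.filter (fun z => z i ≠ x i)).card ≤ 1 := by
      refine (card_filter_le_one_or_le_one hd0 hC hcard i (x i)).resolve_left fun h => hxy ?_
      exact card_le_one.1 h x (by simp [hx]) y (by simp [hy, hxyi])
    rw [← sum_filter_add_sum_filter_not C (fun z => z i = x i)]
    have h1 : ∑ z ∈ C.filter (fun z => z i = x i), (C.filter (fun y => z i ≠ y i)).card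
        = (C.filter (fun z => z i = x i)).card * (C.filter (fun z => z i ≠ x i)).card := by
      rw [← smul_eq_mul, ← sum_const]
      refine sum_congr rfl fun z hz => ?_
      simp only [(mem_filter.1 hz).2, ne_comm]
    have h2 : ∑ z ∈ C.filter (fun z => z i ≠ x i), (C.filter (fun y => z i ≠ y i)).card
        ≤ (C.filter (fun z => z i ≠ x i)).card * (C.card - 1) := by
      rw [← smul_eq_mul]
      refine sum_le_card_nsmul _ _ _ fun z hz => ?_
      have hzC := (mem_filter.1 hz).1
      rw [← card_erase_of_mem hzC]
      refine card_le_card fun y hy => ?_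
      obtain ⟨hyC, hzy⟩ := mem_filter.1 hy
      exact mem_erase.2 ⟨fun h => hzy (h ▸ rfl), hyC⟩
    have h3 := card_filter_add_card_filter_not (s := C) (fun z => z i = x i)
    simp only [← ne_eq] at h3 ⊢
    rw [h1]
    generalize (C.filter (fun z => z i ≠ x i)).card = g at *
    interval_cases g <;> omega
  have hsum := sum_le_sum fun i (_ : i ∈ univ) => hcol i
  have hpairs : ∑ i : Fin n, ∑ x ∈ C, (C.filter (fun y => x i ≠ y i)).card
      = C.card * ((C.card - 1) * d) := by
    rw [sum_comm, ← smul_eq_mul, ← sum_const]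
    refine sum_congr rfl fun x hx => ?_
    have h1 : ∑ i : Fin n, (C.filter (fun y => x i ≠ y i)).card
        = ∑ y ∈ C, hammingDist x y := by
      simp only [card_filter, hammingDist]
      exact sum_comm
    rw [h1, ← add_sum_erase C _ hx, hammingDist_self, zero_add, ← card_erase_of_mem hx,
      ← smul_eq_mul, ← sum_const]
    exact sum_congr rfl fun y hy =>
      hC x hx y (mem_of_mem_erase hy) (ne_of_mem_erase hy).symm
  rw [hpairs, sum_const, card_univ, Fintype.card_fin, smul_eq_mul] at hsum
  have hpos : 0 < C.card - 1 := by omega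
  refine le_of_mul_le_mul_left ?_ hpos
  calc (C.card - 1) * (C.card * d) = C.card * ((C.card - 1) * d) := by ring
    _ ≤ n * (2 * (C.card - 1)) := hsum
    _ = (C.card - 1) * (2 * n) := by ring

end Code

/-- A `q`-ary equidistant code with distance `d > 0` has at most
`max {d² + d + 2, q, ⌊2n/d⌋}` codewords; in particular, if
`n ≥ max {d(d² + d + 2)/2, dq/2}` then it has at most `⌊2n/d⌋` codewords. -/
theorem qary_equidistant_card_le (q n d : ℕ) (hq : 2 ≤ q) (hd0 : 0 < d)
    (C : Finset (Fin n → Fin q))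
    (hC : ∀ x ∈ C, ∀ y ∈ C, x ≠ y → hammingDist x y = d) :
    C.card ≤ max (d ^ 2 + d + 2) (max q (2 * n / d)) ∧
      (max ((d : ℝ) * ((d : ℝ) ^ 2 + d + 2) / 2) ((d : ℝ) * q / 2) ≤ (n : ℝ) →
        C.card ≤ 2 * n / d) := by
  have hmain : C.card ≤ max (d ^ 2 + d + 2) (max q (2 * n / d)) := by
    by_contra! h
    simp only [max_lt_iff] at h
    obtain ⟨h1, h2, h3⟩ := h
    have := (Nat.le_div_iff_mul_le hd0).2 (card_mul_le_two_mul hd0 hC (by omega) h2)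
    omega
  refine ⟨hmain, fun hn => ?_⟩
  obtain ⟨hn1, hn2⟩ := max_le_iff.1 hn
  have h1 : d ^ 2 + d + 2 ≤ 2 * n / d := by
    rw [Nat.le_div_iff_mul_le hd0]
    have : ((d : ℝ) ^ 2 + d + 2) * d ≤ 2 * n := by linarith
    exact_mod_cast this
  have h2 : q ≤ 2 * n / d := by
    rw [Nat.le_div_iff_mul_le hd0]
    have : (q : ℝ) * d ≤ 2 * n := by linarith
    exact_mod_cast this
  exact hmain.trans (max_le h1 (max_le h2 le_rfl))
end
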